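/- arXiv:2009.12889 — 2 statements merged into one kernel-verified Lean document; each statement's English description precedes it below -/
import Mathlib

section
/- For every ordinal α with 1 ≤ α < ω₁ there exists a closed set F ⊆ 2^ω × ω^ω such that for every x ∈ 2^ω the section F_x contains exactly two points, and there is no sequence (B(n))_{n∈ℕ} of subsets of F with ⋃_{n∈ℕ} B(n) = F such that each B(n) belongs to the additive Borel class Σ⁰_α(2^ω × ω^ω) and for every n ∈ ℕ and every x ∈ 2^ω the section B(n)_x contains at most one point. -/
/-- The additive Borel class `Σ⁰_α(Z)` of a topological space `Z`, defined by transfinite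
recursion: `Σ⁰₁(Z)` consists of the open sets, and for `α > 1`, `Σ⁰_α(Z)` consists of the
countable unions `⋃ n, (A n)ᶜ` where each `A n` lies in `Σ⁰_{β n}(Z)` for some
`1 ≤ β n < α`. -/
noncomputable def Sigma0 (Z : Type*) [TopologicalSpace Z] (α : Ordinal) : Set (Set Z) :=
  {s | (α = 1 ∧ IsOpen s) ∨
       (1 < α ∧ ∃ A : ℕ → Set Z, ∃ β : ℕ → Ordinal,
          (∀ n : ℕ, 1 ≤ β n ∧ ∃ hb : β n < α, A n ∈ Sigma0 Z (β n)) ∧ s = ⋃ n, (A n)ᶜ)}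
termination_by α
decreasing_by exact hb

section

open Set Topology

theorem mem_Sigma0_iff {Z : Type*} [TopologicalSpace Z] {α : Ordinal} {s : Set Z} :
    s ∈ Sigma0 Z α ↔ (α = 1 ∧ IsOpen s) ∨
      (1 < α ∧ ∃ A : ℕ → Set Z, ∃ β : ℕ → Ordinal,
        (∀ n : ℕ, 1 ≤ β n ∧ β n < α ∧ A n ∈ Sigma0 Z (β n)) ∧ s = ⋃ n, (A n)ᶜ) := by
  rw [Sigma0]
  simp only [mem_ofPred_eq, exists_prop]

/-- The additive Borel classes are stable under continuous preimages. -/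
theorem Sigma0.preimage {Z Z' : Type*} [TopologicalSpace Z] [TopologicalSpace Z']
    {f : Z → Z'} (hf : Continuous f) (α : Ordinal) :
    ∀ {s : Set Z'}, s ∈ Sigma0 Z' α → f ⁻¹' s ∈ Sigma0 Z α := by
  induction α using WellFoundedLT.induction with
  | ind α ih =>
    intro s hs
    rw [mem_Sigma0_iff] at hs ⊢
    rcases hs with ⟨rfl, hs⟩ | ⟨hα, A, β, hA, rfl⟩
    · exact Or.inl ⟨rfl, hs.preimage hf⟩
    · refine Or.inr ⟨hα, fun n => f ⁻¹' A n, β, fun n => ⟨(hA n).1, (hA n).2.1, ?_⟩, ?_⟩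
      · exact ih (β n) (hA n).2.1 (hA n).2.2
      · simp [preimage_iUnion]

/-- For a countable ordinal `α`, there is a Borel subset of `2^ω × Z` whose sections exhaust
the class `Sigma0 Z α`. -/
theorem exists_measurableSet_universal_Sigma0 {Z : Type*} [TopologicalSpace Z]
    [SecondCountableTopology Z] [MeasurableSpace Z] [BorelSpace Z] (α : Ordinal)
    (hα : α < (Cardinal.aleph 1).ord) :
    ∃ U : Set ((ℕ → Bool) × Z), MeasurableSet U ∧
      ∀ s ∈ Sigma0 Z α, ∃ y, {z | (y, z) ∈ U} = s := by
  induction α using WellFoundedLT.induction with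
  | ind α ih =>
    by_cases h1 : 1 < α
    · have : Countable (Iio α) := by
        rw [← Cardinal.mk_le_aleph0_iff, Cardinal.mk_Iio_ordinal, Cardinal.lift_le_aleph0,
          ← Order.lt_succ_iff, Cardinal.succ_aleph0]
        exact Cardinal.lt_ord.1 hα
      have : Nonempty (Iio α) := ⟨⟨1, h1⟩⟩
      obtain ⟨e, he⟩ := exists_surjective_nat (Iio α)
      choose U hU hUs using fun β : Iio α => ih β β.2 (β.2.trans hα)
      have hc1 : ¬ Countable (ℕ → Bool) := by
        rw [← Cardinal.mk_le_aleph0_iff]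
        simpa using Cardinal.aleph0_lt_continuum
      have hc2 : ¬ Countable (ℕ → ℕ × (ℕ → Bool)) := by
        intro h
        apply hc1
        exact (Function.Injective.countable (f := fun (y : ℕ → Bool) (_ : ℕ) => ((0 : ℕ), y))
          fun a b hab => congrArg Prod.snd (congrFun hab 0))
      let φ : (ℕ → Bool) ≃ᵐ (ℕ → ℕ × (ℕ → Bool)) :=
        PolishSpace.measurableEquivOfNotCountable hc1 hc2
      refine ⟨⋃ k : ℕ, ⋃ i : ℕ, {q | (φ q.1 k).1 = i} ∩
        (fun q : (ℕ → Bool) × Z => ((φ q.1 k).2, q.2)) ⁻¹' (U (e i))ᶜ, ?_, ?_⟩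
      · have hm : ∀ k, Measurable fun q : (ℕ → Bool) × Z => φ q.1 k := fun k =>
          (measurable_pi_apply k).comp (φ.measurable.comp measurable_fst)
        refine .iUnion fun k => .iUnion fun i => .inter ?_ ?_
        · exact (measurable_fst.comp (hm k)) (measurableSet_singleton i)
        · exact ((measurable_snd.comp (hm k)).prodMk measurable_snd) (hU _).compl
      · intro s hs
        rw [mem_Sigma0_iff] at hs
        rcases hs with ⟨rfl, hs⟩ | ⟨_, A, β, hA, rfl⟩
        · exact absurd h1 (lt_irrefl _)
        choose i hi using fun n => he ⟨β n, (hA n).2.1⟩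
        have : ∀ n, ∃ y, {z | (y, z) ∈ U (e (i n))} = A n := fun n => by
          apply hUs
          rw [hi n]
          exact (hA n).2.2
        choose y hy using this
        refine ⟨φ.symm fun n => (i n, y n), ?_⟩
        ext z
        simp [← hy]
    · obtain ⟨b, hbc, -, hb⟩ := TopologicalSpace.exists_countable_basis Z
      have hbn : (insert ∅ b).Nonempty := ⟨∅, mem_insert _ _⟩
      obtain ⟨e, he⟩ := (hbc.insert ∅).exists_eq_range hbn
      have heo : ∀ n, IsOpen (e n) := fun n => by
        have : e n ∈ insert ∅ b := he ▸ mem_range_self n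
        rcases this with h | h
        · rw [h]; exact isOpen_empty
        · exact hb.isOpen h
      refine ⟨⋃ n, {y : ℕ → Bool | y n = true} ×ˢ e n, ?_, ?_⟩
      · refine .iUnion fun n => .prod ?_ (heo n).measurableSet
        exact (measurable_pi_apply n : Measurable fun y : ℕ → Bool => y n)
          (measurableSet_singleton true)
      · intro s hs
        rw [mem_Sigma0_iff] at hs
        rcases hs with ⟨-, hs⟩ | ⟨h, -⟩
        · classical
          refine ⟨fun n => decide (e n ⊆ s), ?_⟩
          ext z
          simp only [mem_iUnion, mem_prod, mem_ofPred_eq, decide_eq_true_eq]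
          constructor
          · rintro ⟨n, hn, hz⟩
            exact hn hz
          · intro hz
            obtain ⟨v, hv, hzv, hvs⟩ := hb.exists_subset_of_mem_open hz hs
            obtain ⟨n, rfl⟩ : v ∈ range e := he ▸ mem_insert_of_mem _ hv
            exact ⟨n, hvs, hzv⟩
        · exact absurd h h1

/-- The basic clopen subset of `ω^ω` determined by a finite sequence. -/
def baireCylinder (t : List ℕ) : Set (ℕ → ℕ) :=
  {r | ∀ i < t.length, r i = t.getD i 0}

theorem isOpen_baireCylinder (t : List ℕ) : IsOpen (baireCylinder t) := by
  have : baireCylinder t = ⋂ i ∈ Finset.range t.length, {r : ℕ → ℕ | r i = t.getD i 0} := by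
    ext r; simp [baireCylinder]
  rw [this]
  refine isOpen_biInter_finset fun i _ => ?_
  exact (isOpen_discrete ({t.getD i 0} : Set ℕ)).preimage
    (continuous_apply i : Continuous fun r : ℕ → ℕ => r i)

theorem nonempty_baireCylinder (t : List ℕ) : (baireCylinder t).Nonempty :=
  ⟨fun i => t.getD i 0, fun _ _ => rfl⟩

/-- The list of the first `m` values of a sequence. -/
def initSeg (v : ℕ → ℕ) (m : ℕ) : List ℕ := (List.range m).map v

@[simp] theorem length_initSeg (v : ℕ → ℕ) (m : ℕ) : (initSeg v m).length = m := by
  simp [initSeg]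

theorem initSeg_getD {v : ℕ → ℕ} {m i : ℕ} (h : i < m) : (initSeg v m).getD i 0 = v i := by
  simp [initSeg, List.getD, h]

theorem initSeg_eq_iff {v : ℕ → ℕ} {m : ℕ} {s : List ℕ} :
    initSeg v m = s ↔ s.length = m ∧ ∀ i < m, v i = s.getD i 0 := by
  constructor
  · rintro rfl
    exact ⟨by simp, fun i hi => (initSeg_getD hi).symm⟩
  · rintro ⟨rfl, h⟩
    apply List.ext_getElem (by simp)
    intro i h1 h2
    simp only [initSeg, List.getElem_map, List.getElem_range]
    rw [h i h2, List.getD_eq_getElem _ _ h2]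

theorem exists_baireCylinder_subset {U : Set (ℕ → ℕ)} (hU : IsOpen U) {r : ℕ → ℕ} (hr : r ∈ U) :
    ∃ m, baireCylinder (initSeg r m) ⊆ U := by
  rw [isOpen_pi_iff] at hU
  obtain ⟨I, u, hu, hIU⟩ := hU r hr
  refine ⟨I.sup id + 1, fun r' hr' => hIU fun i hi => ?_⟩
  have hlt : i < I.sup id + 1 := Nat.lt_succ_of_le (Finset.le_sup (f := id) hi)
  have := hr' i (by simpa using hlt)
  rw [initSeg_getD hlt] at this
  rw [this]
  exact (hu i hi).2

/-- A Borel set which is non-meagre in a cylinder is comeagre in some smaller cylinder. -/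
theorem exists_isMeagre_baireCylinder_diff {A : Set (ℕ → ℕ)} (hA : MeasurableSet A) {t : List ℕ}
    (h : ¬ IsMeagre (baireCylinder t ∩ A)) :
    ∃ t', baireCylinder t' ⊆ baireCylinder t ∧ IsMeagre (baireCylinder t' \ A) := by
  obtain ⟨U, hU, hAU⟩ := hA.residualEq_isOpen
  have hAU' : IsMeagre {r | ¬ (r ∈ A ↔ r ∈ U)} := by
    have := Filter.eventuallyEq_set.1 hAU
    rw [IsMeagre]
    filter_upwards [this] with r hr
    simpa using hr
  by_cases hne : (baireCylinder t ∩ U).Nonempty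
  · obtain ⟨r, hr⟩ := hne
    obtain ⟨m, hm⟩ := exists_baireCylinder_subset ((isOpen_baireCylinder t).inter hU) hr
    refine ⟨initSeg r m, fun x hx => (hm hx).1, hAU'.mono ?_⟩
    rintro x ⟨hx, hxA⟩ hiff
    exact hxA (hiff.2 (hm hx).2)
  · refine absurd (hAU'.mono ?_) h
    rintro x ⟨hx, hxA⟩ hiff
    exact hne ⟨x, hx, hiff.1 hxA⟩

theorem isMeagre_baireCylinder_diff_iff {A : Set (ℕ → ℕ)} (hA : MeasurableSet A) (t : List ℕ) :
    IsMeagre (baireCylinder t \ A) ↔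
      ∀ t', baireCylinder t' ⊆ baireCylinder t → ¬ IsMeagre (baireCylinder t' ∩ A) := by
  constructor
  · intro h t' ht' h'
    refine not_isMeagre_of_isOpen (isOpen_baireCylinder t') (nonempty_baireCylinder t')
      ((h.union h').mono fun r hr => ?_)
    by_cases hrA : r ∈ A
    · exact Or.inr ⟨hr, hrA⟩
    · exact Or.inl ⟨ht' hr, hrA⟩
  · intro h
    by_contra hn
    obtain ⟨t', ht', hm⟩ := exists_isMeagre_baireCylinder_diff hA.compl hn
    refine h t' ht' ?_
    rwa [sdiff_compl] at hm

/-- The category quantifier preserves Borel measurability. -/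
theorem measurableSet_isMeagre_section {Y : Type*} [MeasurableSpace Y]
    {U : Set (Y × (ℕ → ℕ))} (hU : MeasurableSet U) (t : List ℕ) :
    MeasurableSet {y | IsMeagre (baireCylinder t ∩ {r | (y, r) ∈ U})} := by
  rw [← generateFrom_prod] at hU
  have hle : ∀ s, @MeasurableSet _ (MeasurableSpace.generateFrom
      (image2 (fun (s : Set Y) (t : Set (ℕ → ℕ)) => s ×ˢ t)
        {s | MeasurableSet s} {t | MeasurableSet t})) s → MeasurableSet s := fun s hs => by
    rwa [generateFrom_prod] at hs
  induction U, hU using MeasurableSpace.generateFrom_induction generalizing t with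
  | hC s hs _ =>
    obtain ⟨A, hA, B, hB, rfl⟩ := hs
    have : {y | IsMeagre (baireCylinder t ∩ {r | (y, r) ∈ A ×ˢ B})} =
        Aᶜ ∪ {_y | IsMeagre (baireCylinder t ∩ B)} := by
      ext y
      by_cases hy : y ∈ A
      · simp [hy]
      · simp [hy, IsMeagre.empty]
    rw [this]
    exact hA.compl.union (.const _)
  | empty => simp [IsMeagre.empty]
  | compl s hs ih =>
    have : {y | IsMeagre (baireCylinder t ∩ {r | (y, r) ∈ sᶜ})} =
        ⋂ t' : List ℕ, ⋂ _ : baireCylinder t' ⊆ baireCylinder t,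
          {y | IsMeagre (baireCylinder t' ∩ {r | (y, r) ∈ s})}ᶜ := by
      ext y
      simp only [mem_iInter]
      exact isMeagre_baireCylinder_diff_iff (measurable_prodMk_left (hle s hs)) t
    rw [this]
    exact .iInter fun t' => .iInter fun _ => (ih t').compl
  | iUnion s hs ih =>
    have : {y | IsMeagre (baireCylinder t ∩ {r | (y, r) ∈ ⋃ i, s i})} =
        ⋂ i, {y | IsMeagre (baireCylinder t ∩ {r | (y, r) ∈ s i})} := by
      ext y
      rw [mem_iInter]
      simp only [mem_ofPred_eq]
      constructor
      · intro h i
        refine h.mono ?_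
        rintro r ⟨hr, hi⟩
        exact ⟨hr, mem_iUnion.2 ⟨i, hi⟩⟩
      · intro h
        refine (isMeagre_iUnion h).mono ?_
        rintro r ⟨hr, hi⟩
        obtain ⟨i, hi⟩ := mem_iUnion.1 hi
        exact mem_iUnion.2 ⟨i, hr, hi⟩
    rw [this]
    exact .iInter fun i => ih i t

/-- `HasClosedGraphCode f` says that `f` is the zeroth coordinate of a map into Baire space with
closed graph. -/
def HasClosedGraphCode {Y : Type*} [TopologicalSpace Y] (f : Y → ℕ) : Prop :=
  ∃ w : Y → ℕ → ℕ, IsClosed {q : Y × (ℕ → ℕ) | q.2 = w q.1} ∧ ∀ y, w y 0 = f y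

section ClosedGraph

variable {Y : Type*} [TopologicalSpace Y]

theorem HasClosedGraphCode.of_continuous {f : Y → ℕ} (hf : Continuous f) :
    HasClosedGraphCode f :=
  ⟨fun y _ => f y, isClosed_eq continuous_snd
    (continuous_pi fun _ => hf.comp continuous_fst), fun _ => rfl⟩

theorem HasClosedGraphCode.of_isClosed {f : ℕ → Y → ℕ} (hf : ∀ k, HasClosedGraphCode (f k))
    {g : Y → ℕ} {G : Set ((ℕ → ℕ) × ℕ)} (hG : IsClosed G)
    (hg : ∀ y j, (fun k => f k y, j) ∈ G ↔ j = g y) : HasClosedGraphCode g := by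
  choose w hw hwf using hf
  refine ⟨fun y n => n.casesOn (g y) fun n => w n.unpair.1 y n.unpair.2, ?_, fun _ => rfl⟩
  have hset : {q : Y × (ℕ → ℕ) | q.2 = fun n => n.casesOn (g q.1) fun n =>
        w n.unpair.1 q.1 n.unpair.2} =
      (⋂ k, (fun q : Y × (ℕ → ℕ) => (q.1, fun n => q.2 (Nat.pair k n + 1))) ⁻¹'
        {q | q.2 = w k q.1}) ∩
      (fun q : Y × (ℕ → ℕ) => (fun k => q.2 (Nat.pair k 0 + 1), q.2 0)) ⁻¹' G := by
    ext ⟨y, v⟩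
    simp only [mem_inter_iff, mem_iInter, mem_preimage, mem_ofPred_eq]
    constructor
    · rintro rfl
      refine ⟨fun k => ?_, ?_⟩
      · funext n
        simp
      · simp only [Nat.unpair_pair, hwf]
        exact (hg y _).2 rfl
    · rintro ⟨h1, h2⟩
      have h3 : (fun k => v (Nat.pair k 0 + 1)) = fun k => f k y := by
        funext k
        rw [← hwf k y, ← h1 k]
      rw [h3] at h2
      funext n
      cases n with
      | zero => exact (hg y _).1 h2
      | succ n =>
        have := congrFun (h1 n.unpair.1) n.unpair.2
        simpa using this
  rw [hset]
  refine (isClosed_iInter fun k => (hw k).preimage ?_).inter (hG.preimage ?_) <;> fun_prop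

theorem HasClosedGraphCode.comp {f : Y → ℕ} (hf : HasClosedGraphCode f) (h : ℕ → ℕ) :
    HasClosedGraphCode fun y => h (f y) := by
  refine .of_isClosed (f := fun _ => f) (fun _ => hf) (G := {q | q.2 = h (q.1 0)}) ?_
    fun y j => Iff.rfl
  exact isClosed_eq continuous_snd
    (continuous_of_discreteTopology.comp ((continuous_apply 0).comp continuous_fst))

theorem HasClosedGraphCode.indicator_iUnion {s : ℕ → Set Y}
    (hs : ∀ k, HasClosedGraphCode ((s k).indicator fun _ => 1)) :
    HasClosedGraphCode ((⋃ k, s k).indicator fun _ => 1) := by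
  classical
  have hg : HasClosedGraphCode fun y => if h : ∃ k, y ∈ s k then Nat.find h + 1 else 0 := by
    refine .of_isClosed hs (G := ⋂ k, {q : (ℕ → ℕ) × ℕ | k + 1 < q.2 → q.1 k = 0} ∩
      {q | q.2 = 0 → q.1 k = 0} ∩ {q | q.2 = k + 1 → q.1 k ≠ 0}) ?_ fun y j => ?_
    · refine isClosed_iInter fun k => ?_
      have hk : Continuous fun q : (ℕ → ℕ) × ℕ => (q.1 k, q.2) :=
        ((continuous_apply k).comp continuous_fst).prodMk continuous_snd
      refine .inter (.inter ?_ ?_) ?_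
      · exact (isClosed_discrete {p : ℕ × ℕ | k + 1 < p.2 → p.1 = 0}).preimage hk
      · exact (isClosed_discrete {p : ℕ × ℕ | p.2 = 0 → p.1 = 0}).preimage hk
      · exact (isClosed_discrete {p : ℕ × ℕ | p.2 = k + 1 → p.1 ≠ 0}).preimage hk
    · simp only [mem_iInter, mem_inter_iff, mem_ofPred_eq, indicator_apply_eq_zero, ne_eq,
        one_ne_zero, imp_false]
      constructor
      · intro h
        split_ifs with hy
        · rcases j with _ | j
          · exact absurd (Nat.find_spec hy) ((h _).1.2 rfl)
          · refine congrArg (· + 1) (le_antisymm ?_ ?_)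
            · by_contra! hlt
              exact (h _).1.1 (Nat.succ_lt_succ hlt) (Nat.find_spec hy)
            · exact Nat.find_min' hy (not_not.1 ((h j).2 rfl))
        · rcases j with _ | j
          · rfl
          · exact absurd ⟨j, not_not.1 ((h j).2 rfl)⟩ hy
      · intro h k
        split_ifs at h with hy
        · subst h
          refine ⟨⟨fun hk => Nat.find_min hy (Nat.lt_of_succ_lt_succ hk), fun h => by omega⟩,
            fun hk => ?_⟩
          rw [← Nat.succ.inj hk, not_not]
          exact Nat.find_spec hy
        · push Not at hy
          subst h
          exact ⟨⟨fun _ => hy k, fun _ => hy k⟩, fun h => by omega⟩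
  convert hg.comp fun n => if n = 0 then 0 else 1 using 2 with y
  by_cases hy : ∃ k, y ∈ s k
  · simp [hy]
  · simp [hy]

theorem HasClosedGraphCode.of_indicator {f : Y → ℕ}
    (hf : ∀ k, HasClosedGraphCode ((f ⁻¹' {k}).indicator fun _ => 1)) :
    HasClosedGraphCode f := by
  refine .of_isClosed hf (G := {q | q.1 q.2 = 1}) ?_ fun y j => ?_
  · have : {q : (ℕ → ℕ) × ℕ | q.1 q.2 = 1} = ⋂ j, {q | q.2 = j → q.1 j = 1} := by
      ext q; simp
    rw [this]
    refine isClosed_iInter fun j => ?_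
    have hj : Continuous fun q : (ℕ → ℕ) × ℕ => (q.1 j, q.2) :=
      ((continuous_apply j).comp continuous_fst).prodMk continuous_snd
    exact (isClosed_discrete {p : ℕ × ℕ | p.2 = j → p.1 = 1}).preimage hj
  · by_cases hj : j = f y
    · simp [hj]
    · simp [hj, Ne.symm hj]

end ClosedGraph

/-- Every Borel function from Cantor space to `ℕ` is the zeroth coordinate of a map into Baire
space with closed graph. -/
theorem Measurable.hasClosedGraphCode {f : (ℕ → Bool) → ℕ} (hf : Measurable f) :
    HasClosedGraphCode f := by
  let m : MeasurableSpace (ℕ → Bool) :=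
    { MeasurableSet' := fun s => HasClosedGraphCode (s.indicator fun _ => 1)
      measurableSet_empty := by
        simpa using HasClosedGraphCode.of_continuous (continuous_const (y := 0))
      measurableSet_compl := fun s hs => by
        classical
        convert hs.comp fun n => if n = 0 then 1 else 0 using 2 with y
        by_cases hy : y ∈ s <;> simp [hy]
      measurableSet_iUnion := fun s hs => .indicator_iUnion hs }
  have hle : MeasurableSpace.pi ≤ m := by
    refine iSup_le fun i => ?_
    rintro _ ⟨s, -, rfl⟩
    refine HasClosedGraphCode.of_continuous ?_
    refine continuous_const.indicator fun a ha => ?_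
    have : IsClopen ((fun y : ℕ → Bool => y i) ⁻¹' s) :=
      (isClopen_discrete s).preimage (continuous_apply i)
    rw [this.frontier_eq] at ha
    exact ha.elim
  exact .of_indicator fun k => hle _ (hf (measurableSet_singleton k))

/-- A map with closed graph between Polish spaces is Borel. -/
theorem measurable_of_isClosed_graph {Y Z : Type*} [TopologicalSpace Y] [PolishSpace Y]
    [MeasurableSpace Y] [BorelSpace Y] [TopologicalSpace Z] [PolishSpace Z]
    [MeasurableSpace Z] [BorelSpace Z] {w : Y → Z}
    (hw : IsClosed {q : Y × Z | q.2 = w q.1}) : Measurable w := by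
  intro N hN
  have hm : MeasurableSet ({q : Y × Z | q.2 = w q.1} ∩ Prod.snd ⁻¹' N) :=
    hw.measurableSet.inter (measurable_snd hN)
  have himg : w ⁻¹' N = Prod.fst '' ({q : Y × Z | q.2 = w q.1} ∩ Prod.snd ⁻¹' N) := by
    ext y
    constructor
    · exact fun h => ⟨(y, w y), ⟨rfl, h⟩, rfl⟩
    · rintro ⟨⟨y, z⟩, ⟨hz, h⟩, rfl⟩
      change z = w y at hz
      subst hz
      exact h
  rw [himg]
  refine hm.image_of_continuousOn_injOn continuous_fst.continuousOn ?_
  rintro ⟨y, z⟩ ⟨hz, -⟩ ⟨y', z'⟩ ⟨hz', -⟩ (rfl : y = y')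
  rw [mem_ofPred_eq] at hz hz'
  simp_all

open scoped symmDiff

/-- A bijective enumeration of the finite sets of finite sequences. -/
def finsetOfNat : ℕ ≃ Finset (List ℕ) := (Denumerable.eqv (Finset (List ℕ))).symm

/-- The level-`m` part of the tail of the branch `v` which starts at level `v 0 + 1`. -/
def branchFlip (v : ℕ → ℕ) (m : ℕ) : Finset (List ℕ) := if v 0 < m then {initSeg v m} else ∅

/-- The involution which toggles the nodes of the branch `v` in a coded sequence of finite
sets. -/
def twist (v r : ℕ → ℕ) : ℕ → ℕ :=
  fun m => finsetOfNat.symm (finsetOfNat (r m) ∆ branchFlip v m)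

theorem finsetOfNat_twist (v r : ℕ → ℕ) (m : ℕ) :
    finsetOfNat (twist v r m) = finsetOfNat (r m) ∆ branchFlip v m := by
  simp [twist]

theorem twist_twist (v r : ℕ → ℕ) : twist v (twist v r) = r := by
  funext m
  simp [twist]

theorem initSeg_mem_twist_iff (v r : ℕ → ℕ) :
    initSeg v (v 0 + 1) ∈ finsetOfNat (twist v r (v 0 + 1)) ↔
      initSeg v (v 0 + 1) ∉ finsetOfNat (r (v 0 + 1)) := by
  simp [finsetOfNat_twist, branchFlip, Finset.mem_symmDiff]

theorem twist_ne (v r : ℕ → ℕ) : twist v r ≠ r := by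
  intro h
  have := initSeg_mem_twist_iff v r
  rw [h] at this
  tauto

theorem twist_mem_baireCylinder {v r : ℕ → ℕ} {t : List ℕ} (ht : t.length ≤ v 0)
    (hr : r ∈ baireCylinder t) : twist v r ∈ baireCylinder t := by
  intro i hi
  rw [← hr i hi]
  have : ¬ v 0 < i := by omega
  have hE : finsetOfNat (r i) ∆ ∅ = finsetOfNat (r i) := symmDiff_bot _
  simp [twist, branchFlip, this, hE]

theorem continuous_twist (v : ℕ → ℕ) : Continuous (twist v) :=
  continuous_pi fun m => (continuous_of_discreteTopology
    (f := fun k => finsetOfNat.symm (finsetOfNat k ∆ branchFlip v m))).comp (continuous_apply m)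

/-- `twist v` as a self-homeomorphism of Baire space. -/
def twistHomeomorph (v : ℕ → ℕ) : (ℕ → ℕ) ≃ₜ (ℕ → ℕ) where
  toFun := twist v
  invFun := twist v
  left_inv := twist_twist v
  right_inv := twist_twist v
  continuous_toFun := continuous_twist v
  continuous_invFun := continuous_twist v

/-- A finite sequence is active if it is longer than its first entry. -/
def IsActive (s : List ℕ) : Prop := s.headI < s.length

theorem isActive_initSeg {v : ℕ → ℕ} {m : ℕ} : IsActive (initSeg v m) ↔ v 0 < m := by
  cases m with
  | zero => simp [IsActive, initSeg]
  | succ m => simp [IsActive, initSeg, List.range_succ_eq_map]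

theorem dropLast_initSeg (v : ℕ → ℕ) (m : ℕ) : (initSeg v (m + 1)).dropLast = initSeg v m := by
  simp [initSeg, List.range_succ]

/-- `IsCandidate w m u s` says that `s` is an initial segment of length `m` of a value of `w` at
some point extending `u`. -/
def IsCandidate (w : (ℕ → Bool) → ℕ → ℕ) (m : ℕ) (u : Fin m → Bool) (s : List ℕ) : Prop :=
  ∃ y, (∀ i : Fin m, y i = u i) ∧ s = initSeg (w y) m

/-- The parity of the number of children of `s` in `A`, plus one if `s ∈ B`. -/
def childParity (A B : Finset (List ℕ)) (s : List ℕ) : ZMod 2 :=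
  ({t ∈ A | t.dropLast = s}.card : ZMod 2) + if s ∈ B then 1 else 0

theorem cast_card_symmDiff {ι : Type*} [DecidableEq ι] (A B : Finset ι) :
    ((A ∆ B).card : ZMod 2) = A.card + B.card := by
  have h1 : (A ∆ B).card = (A \ B).card + (B \ A).card :=
    Finset.card_union_of_disjoint disjoint_sdiff_sdiff
  have h2 := Finset.card_sdiff_add_card_inter A B
  have h3 := Finset.card_sdiff_add_card_inter B A
  rw [Finset.inter_comm] at h3
  rw [h1, ← h2, ← h3]
  push_cast
  linear_combination -(CharTwo.add_self_eq_zero ((A ∩ B).card : ZMod 2))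

theorem childParity_symmDiff (A A' B B' : Finset (List ℕ)) (s : List ℕ) :
    childParity (A ∆ A') (B ∆ B') s = childParity A B s + childParity A' B' s := by
  have h : ({t ∈ A ∆ A' | t.dropLast = s} : Finset (List ℕ)) =
      {t ∈ A | t.dropLast = s} ∆ {t ∈ A' | t.dropLast = s} := by
    ext t
    simp only [Finset.mem_filter, Finset.mem_symmDiff]
    tauto
  rw [childParity, h, cast_card_symmDiff, childParity, childParity]
  by_cases h1 : s ∈ B <;> by_cases h2 : s ∈ B' <;>
    simp only [h1, h2, Finset.mem_symmDiff, not_true, not_false_iff, and_true, and_false, or_self,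
      or_true, or_false, if_true, if_false]
  · linear_combination -(CharTwo.add_self_eq_zero (1 : ZMod 2))
  all_goals ring

/-- The sequences of finite sets by which two codes with the same `pairCode` may differ. -/
def IsNegligible (w : (ℕ → Bool) → ℕ → ℕ) (y : ℕ → Bool) (d : ℕ → Finset (List ℕ)) : Prop :=
  (∀ m, ∀ s ∈ d m, IsActive s ∧ IsCandidate w m (fun i => y i) s) ∧
    ∀ s, IsActive s → childParity (d (s.length + 1)) (d s.length) s = 0

theorem isNegligible_branchFlip (w : (ℕ → Bool) → ℕ → ℕ) (y : ℕ → Bool) :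
    IsNegligible w y (branchFlip (w y)) := by
  refine ⟨fun m s hs => ?_, fun s hs => ?_⟩
  · rw [branchFlip] at hs
    split_ifs at hs with h
    · rw [Finset.mem_singleton] at hs
      subst hs
      exact ⟨isActive_initSeg.2 h, y, fun _ => rfl, rfl⟩
    · simp at hs
  · by_cases h : s = initSeg (w y) s.length
    · have h0 : w y 0 < s.length := by
        rw [h, isActive_initSeg] at hs
        exact hs
      simp only [childParity, branchFlip, h0, Nat.lt_succ_of_lt h0, if_true,
        Finset.filter_singleton, dropLast_initSeg, Finset.mem_singleton]
      rw [if_pos h.symm, if_pos h]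
      exact CharTwo.add_self_eq_zero (1 : ZMod 2)
    · have h1 : s ∉ branchFlip (w y) s.length := by
        rw [branchFlip]
        split_ifs <;> simp [h]
      have h2 : ∀ t ∈ branchFlip (w y) (s.length + 1), ¬ t.dropLast = s := by
        rw [branchFlip]
        split_ifs
        · simp [dropLast_initSeg, Ne.symm h]
        · simp
      simp [childParity, h1, Finset.filter_false_of_mem h2]

theorem exists_forall_initSeg_mem {d : ℕ → Finset (List ℕ)} (hl : ∀ m, ∀ s ∈ d m, s.length = m)
    (hd : ∀ m, ∀ s ∈ d m, ∃ t ∈ d (m + 1), t.dropLast = s) {m : ℕ} {s : List ℕ} (hs : s ∈ d m) :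
    ∃ v : ℕ → ℕ, initSeg v m = s ∧ ∀ k, initSeg v (m + k) ∈ d (m + k) := by
  choose! g hg hgd using hd
  obtain ⟨c, hc0, hcs⟩ : ∃ c : ℕ → List ℕ, c 0 = s ∧ ∀ k, c (k + 1) = g (m + k) (c k) :=
    ⟨fun k => Nat.rec s (fun k t => g (m + k) t) k, rfl, fun _ => rfl⟩
  have hc : ∀ k, c k ∈ d (m + k) := fun k => by
    induction k with
    | zero => rwa [hc0]
    | succ k ih => rw [hcs]; exact hg _ _ ih
  have hcl : ∀ k, (c k).length = m + k := fun k => hl _ _ (hc k)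
  have hcp : ∀ k, c k <+: c (k + 1) := fun k => by
    have : (c (k + 1)).dropLast = c k := by
      rw [hcs]; exact hgd _ _ (hc k)
    rw [← this]
    exact List.dropLast_prefix _
  have hcm : ∀ j k, j ≤ k → c j <+: c k := fun j k h => by
    induction k, h using Nat.le_induction with
    | base => exact List.prefix_rfl
    | succ k _ ih => exact ih.trans (hcp k)
  have hv : ∀ k, initSeg (fun i => (c (i + 1)).getD i 0) (m + k) = c k := fun k => by
    refine initSeg_eq_iff.2 ⟨hcl k, fun i hi => ?_⟩
    have h1 : i < (c (i + 1)).length := by rw [hcl]; omega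
    have h2 : i < (c k).length := by rw [hcl]; omega
    rw [List.getD_eq_getElem _ _ h1, List.getD_eq_getElem _ _ h2]
    rcases le_total (i + 1) k with h | h
    · exact (hcm _ _ h).getElem h1
    · exact ((hcm _ _ h).getElem h2).symm
  exact ⟨_, (hv 0).trans hc0, fun k => by rw [hv]; exact hc k⟩

theorem tendsto_pi_of_eq {α : Type*} [TopologicalSpace α] {u : ℕ → ℕ → α} {v : ℕ → α}
    (h : ∀ k, ∀ i < k, u k i = v i) : Filter.Tendsto u Filter.atTop (𝓝 v) := by
  refine tendsto_pi_nhds.2 fun i => tendsto_const_nhds.congr' ?_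
  filter_upwards [Filter.eventually_gt_atTop i] with k hk
  exact (h k i hk).symm

theorem IsNegligible.eq_or_eq {w : (ℕ → Bool) → ℕ → ℕ}
    (hw : IsClosed {q : (ℕ → Bool) × (ℕ → ℕ) | q.2 = w q.1}) {y : ℕ → Bool}
    {d : ℕ → Finset (List ℕ)} (hd : IsNegligible w y d) :
    (∀ m, d m = ∅) ∨ ∀ m, d m = branchFlip (w y) m := by
  obtain ⟨hd1, hd2⟩ := hd
  have hl : ∀ m, ∀ s ∈ d m, s.length = m := fun m s hs => by
    obtain ⟨-, y', -, rfl⟩ := hd1 m s hs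
    simp
  have hchild : ∀ m, ∀ s ∈ d m, ∃ t ∈ d (m + 1), t.dropLast = s := fun m s hs => by
    have h := hd2 s (hd1 m s hs).1
    rw [hl m s hs, childParity, if_pos hs] at h
    by_contra! hne
    rw [Finset.filter_false_of_mem hne] at h
    simp at h
  have hsub : ∀ m, ∀ s ∈ d m, s = initSeg (w y) m := fun m s hs => by
    obtain ⟨v, rfl, hv⟩ := exists_forall_initSeg_mem hl hchild hs
    choose hact y' hy' hyv using fun k => hd1 _ _ (hv k)
    have h1 : Filter.Tendsto y' Filter.atTop (𝓝 y) :=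
      tendsto_pi_of_eq fun k i hi => hy' k ⟨i, by omega⟩
    have h2 : Filter.Tendsto (fun k => w (y' k)) Filter.atTop (𝓝 v) :=
      tendsto_pi_of_eq fun k i hi => by
        have hi' : i < m + k := by omega
        rw [← initSeg_getD (v := v) hi', hyv k, initSeg_getD hi']
    have h3 : v = w y := hw.mem_of_tendsto (h1.prodMk_nhds h2) (Filter.Eventually.of_forall
      fun _ => rfl)
    rw [h3]
  have hact : ∀ m, initSeg (w y) m ∈ d m → w y 0 < m := fun m hm =>
    isActive_initSeg.1 (hd1 m _ hm).1
  have hstep : ∀ m, w y 0 < m → (initSeg (w y) m ∈ d m ↔ initSeg (w y) (m + 1) ∈ d (m + 1)) := by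
    intro m hm
    constructor
    · intro h
      obtain ⟨t, ht, -⟩ := hchild m _ h
      rwa [← hsub _ t ht]
    · intro h
      have h2 := hd2 _ (isActive_initSeg.2 hm)
      rw [length_initSeg, childParity] at h2
      have h3 : d (m + 1) = {initSeg (w y) (m + 1)} :=
        Finset.eq_singleton_iff_unique_mem.2 ⟨h, hsub _⟩
      by_contra hn
      rw [h3, if_neg hn, Finset.filter_singleton, if_pos (dropLast_initSeg _ _)] at h2
      simp at h2
  have hall : ∀ m, w y 0 + 1 ≤ m →
      (initSeg (w y) m ∈ d m ↔ initSeg (w y) (w y 0 + 1) ∈ d (w y 0 + 1)) := fun m hm => by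
    induction m, hm using Nat.le_induction with
    | base => rfl
    | succ m hm ih => rw [← ih, hstep m hm]
  by_cases h0 : initSeg (w y) (w y 0 + 1) ∈ d (w y 0 + 1)
  · right
    intro m
    rw [branchFlip]
    split_ifs with h
    · exact Finset.eq_singleton_iff_unique_mem.2 ⟨(hall m h).2 h0, hsub _⟩
    · exact Finset.eq_empty_of_forall_notMem fun s hs => h (hact m (hsub m s hs ▸ hs))
  · left
    intro m
    refine Finset.eq_empty_of_forall_notMem fun s hs => ?_
    rw [hsub m s hs] at hs
    exact h0 ((hall m (hact m hs)).1 hs)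

open Classical in
/-- Membership of `s` in the finite set coded by `p.2`, forgotten if `s` is an active
candidate. -/
noncomputable def memberBit (w : (ℕ → Bool) → ℕ → ℕ) (m : ℕ) (s : List ℕ)
    (p : (Fin m → Bool) × ℕ) : Bool :=
  decide (s ∈ finsetOfNat p.2 ∧ ¬ (IsActive s ∧ IsCandidate w m p.1 s))

open Classical in
/-- The `childParity` of an active sequence in a pair of coded finite sets. -/
noncomputable def parityBit (s : List ℕ) (p : ℕ × ℕ) : Bool :=
  decide (IsActive s ∧ childParity (finsetOfNat p.1) (finsetOfNat p.2) s = 1)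

/-- The continuous map which codes `y` together with the class of `r` modulo
`twist (w y)`. -/
noncomputable def pairCode (w : (ℕ → Bool) → ℕ → ℕ) (q : (ℕ → Bool) × (ℕ → ℕ)) (n : ℕ) : Bool :=
  match Denumerable.ofNat (ℕ ⊕ (ℕ × List ℕ) ⊕ List ℕ) n with
  | .inl i => q.1 i
  | .inr (.inl (m, s)) => memberBit w m s (fun i => q.1 i, q.2 m)
  | .inr (.inr s) => parityBit s (q.2 (s.length + 1), q.2 s.length)

theorem continuous_pairCode (w : (ℕ → Bool) → ℕ → ℕ) : Continuous (pairCode w) := by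
  refine continuous_pi fun n => ?_
  unfold pairCode
  rcases Denumerable.ofNat (ℕ ⊕ (ℕ × List ℕ) ⊕ List ℕ) n with i | ⟨m, s⟩ | s
  · exact (continuous_apply i).comp continuous_fst
  · exact (continuous_of_discreteTopology (f := memberBit w m s)).comp (by fun_prop)
  · exact (continuous_of_discreteTopology (f := parityBit s)).comp (by fun_prop)

/-- The continuous left inverse of the first coordinate of `pairCode`. -/
def pairBase (x : ℕ → Bool) : ℕ → Bool :=
  fun i => x (Encodable.encode (Sum.inl i : ℕ ⊕ (ℕ × List ℕ) ⊕ List ℕ))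

theorem continuous_pairBase : Continuous pairBase :=
  continuous_pi fun _ => continuous_apply _

theorem pairBase_pairCode (w : (ℕ → Bool) → ℕ → ℕ) (q : (ℕ → Bool) × (ℕ → ℕ)) :
    pairBase (pairCode w q) = q.1 := by
  funext i
  simp only [pairBase, pairCode, Denumerable.ofNat_encode]

theorem pairCode_eq_iff_isNegligible {w : (ℕ → Bool) → ℕ → ℕ} {y : ℕ → Bool} {r r' : ℕ → ℕ} :
    pairCode w (y, r) = pairCode w (y, r') ↔
      IsNegligible w y fun m => finsetOfNat (r m) ∆ finsetOfNat (r' m) := by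
  have hsurj : pairCode w (y, r) = pairCode w (y, r') ↔
      ∀ j : ℕ ⊕ (ℕ × List ℕ) ⊕ List ℕ, pairCode w (y, r) (Encodable.encode j) =
        pairCode w (y, r') (Encodable.encode j) := by
    constructor
    · intro h j
      rw [h]
    · intro h
      funext n
      simpa using h (Denumerable.ofNat _ n)
  rw [hsurj, IsNegligible]
  simp only [Sum.forall, Prod.forall, pairCode, Denumerable.ofNat_encode, memberBit,
    parityBit, decide_eq_decide,
    childParity_symmDiff, Finset.mem_symmDiff]
  refine ⟨fun ⟨_, h1, h2⟩ => ⟨fun m s hs => ?_, fun s hs => ?_⟩, fun ⟨h1, h2⟩ =>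
    ⟨fun _ => trivial, fun m s => ?_, fun s => ?_⟩⟩
  · have := h1 m s
    tauto
  · have := h2 s
    simp only [hs, true_and] at this
    revert this
    generalize childParity _ _ _ = a
    generalize childParity _ _ _ = b
    revert a b
    decide
  · have := h1 m s
    tauto
  · refine and_congr_right fun hs => ?_
    have := h2 s hs
    revert this
    generalize childParity _ _ _ = a
    generalize childParity _ _ _ = b
    revert a b
    decide

theorem pairCode_eq_iff {w : (ℕ → Bool) → ℕ → ℕ}
    (hw : IsClosed {q : (ℕ → Bool) × (ℕ → ℕ) | q.2 = w q.1}) {y : ℕ → Bool} {r r' : ℕ → ℕ} :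
    pairCode w (y, r') = pairCode w (y, r) ↔ r' = r ∨ r' = twist (w y) r := by
  rw [pairCode_eq_iff_isNegligible]
  constructor
  · intro h
    rcases h.eq_or_eq hw with h | h
    · left
      funext m
      exact finsetOfNat.injective (symmDiff_eq_bot.1 (h m))
    · right
      funext m
      apply finsetOfNat.injective
      rw [finsetOfNat_twist, ← h m, symmDiff_comm, symmDiff_symmDiff_cancel_right]
  · rintro (rfl | rfl)
    · simp [IsNegligible, childParity]
    · convert isNegligible_branchFlip w y using 2 with m
      rw [finsetOfNat_twist, symmDiff_comm, symmDiff_symmDiff_cancel_left]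

/-- For a countable ordinal `α` there is a Borel function `n` on Cantor space such that every
countable cover of `2^ω × ω^ω` by sets in `Sigma0 _ α` has a member some section of which, at a
point `y`, is comeagre in a cylinder of length `n y`. -/
theorem exists_measurable_comeagre_cylinder (α : Ordinal) (hα : α < (Cardinal.aleph 1).ord) :
    ∃ n : (ℕ → Bool) → ℕ, Measurable n ∧ ∀ A : ℕ → Set ((ℕ → Bool) × (ℕ → ℕ)),
      (∀ k, A k ∈ Sigma0 ((ℕ → Bool) × (ℕ → ℕ)) α) → (∀ q, ∃ k, q ∈ A k) →
      ∃ y k t, t.length = n y ∧ IsMeagre (baireCylinder t \ {r | (y, r) ∈ A k}) := by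
  classical
  obtain ⟨U, hU, hUs⟩ := exists_measurableSet_universal_Sigma0 (Z := (ℕ → Bool) × (ℕ → ℕ)) α hα
  have hc1 : ¬ Countable (ℕ → Bool) := by
    rw [← Cardinal.mk_le_aleph0_iff]
    simpa using Cardinal.aleph0_lt_continuum
  have hc2 : ¬ Countable (ℕ → ℕ → Bool) := fun h => hc1 <|
    Function.Injective.countable (f := fun (y : ℕ → Bool) (_ : ℕ) => y)
      fun a b hab => congrFun hab 0
  let φ : (ℕ → Bool) ≃ᵐ (ℕ → ℕ → Bool) := PolishSpace.measurableEquivOfNotCountable hc1 hc2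
  let W : ℕ → Set ((ℕ → Bool) × (ℕ → ℕ)) := fun k => (fun q => (φ q.1 k, q)) ⁻¹' U
  have hW : ∀ k, MeasurableSet (W k) := fun k =>
    (((measurable_pi_apply k).comp (φ.measurable.comp measurable_fst)).prodMk measurable_id) hU
  let G : ℕ → Set (ℕ → Bool) := fun m => ⋃ k, ⋃ t : List ℕ, ⋃ _ : t.length = m,
    {y | IsMeagre (baireCylinder t \ {r | (y, r) ∈ W k})}
  have hG : ∀ m, MeasurableSet (G m) := fun m => .iUnion fun k => .iUnion fun t => .iUnion fun _ =>
    measurableSet_isMeagre_section (hW k).compl t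
  have hP : ∀ y, ∃ m, y ∈ G m ∪ ⋂ m', (G m')ᶜ := fun y => by
    by_cases h : ∃ m, y ∈ G m
    · exact h.imp fun m hm => Or.inl hm
    · push Not at h
      exact ⟨0, Or.inr (mem_iInter.2 h)⟩
  refine ⟨fun y => Nat.find (hP y), measurable_find hP fun m =>
    (hG m).union (.iInter fun m' => (hG m').compl), fun A hA hcov => ?_⟩
  choose c hc using fun k => hUs (A k) (hA k)
  have hWA : ∀ k r, (φ.symm c, r) ∈ W k ↔ (φ.symm c, r) ∈ A k := fun k r => by
    rw [← hc k]
    simp [W]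
  have hne : ∃ k, ¬ IsMeagre (baireCylinder [] ∩ {r | (φ.symm c, r) ∈ W k}) := by
    by_contra! h
    refine not_isMeagre_of_isOpen (isOpen_baireCylinder []) (nonempty_baireCylinder [])
      ((isMeagre_iUnion h).mono fun r hr => ?_)
    obtain ⟨k, hk⟩ := hcov (φ.symm c, r)
    exact mem_iUnion.2 ⟨k, hr, (hWA k r).2 hk⟩
  obtain ⟨k, hk⟩ := hne
  obtain ⟨t, -, ht⟩ := exists_isMeagre_baireCylinder_diff (measurable_prodMk_left (hW k)) hk
  have hmem : φ.symm c ∈ G t.length :=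
    mem_iUnion.2 ⟨k, mem_iUnion.2 ⟨t, mem_iUnion.2 ⟨rfl, ht⟩⟩⟩
  have hfind := Nat.find_spec (hP (φ.symm c))
  rcases hfind with h | h
  · obtain ⟨k, h⟩ := mem_iUnion.1 h
    obtain ⟨t, h⟩ := mem_iUnion.1 h
    obtain ⟨hl, h⟩ := mem_iUnion.1 h
    refine ⟨φ.symm c, k, t, hl, ?_⟩
    simp only [mem_ofPred_eq, hWA] at h
    exact h
  · exact absurd hmem (mem_iInter.1 h _)

theorem isOpen_setOf_initSeg_eq (m : ℕ) (s : List ℕ) : IsOpen {v | initSeg v m = s} := by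
  by_cases h : s.length = m
  · have : {v | initSeg v m = s} = baireCylinder s := by
      ext v
      simp [initSeg_eq_iff, h, baireCylinder]
    rw [this]
    exact isOpen_baireCylinder s
  · simp [initSeg_eq_iff, h]

theorem measurableSet_range_pairCode {w : (ℕ → Bool) → ℕ → ℕ}
    (hw : IsClosed {q : (ℕ → Bool) × (ℕ → ℕ) | q.2 = w q.1}) :
    MeasurableSet (range (pairCode w)) := by
  have : PolishSpace (ℕ → Bool) := {}
  have hwm := measurable_of_isClosed_graph hw
  let T : Set ((ℕ → Bool) × (ℕ → ℕ)) :=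
    {q | initSeg (w q.1) (w q.1 0 + 1) ∉ finsetOfNat (q.2 (w q.1 0 + 1))}
  have hT : MeasurableSet T := by
    have : T = ⋂ k, ⋂ s, ((fun q => w q.1) ⁻¹' ({v | v 0 = k} ∩ {v | initSeg v (k + 1) = s}) ∩
        Prod.snd ⁻¹' {r | s ∈ finsetOfNat (r (k + 1))})ᶜ := by
      ext q
      simp [T]
    rw [this]
    refine .iInter fun k => .iInter fun s => .compl (.inter ?_ ?_)
    · refine (hwm.comp measurable_fst) (.inter ?_ (isOpen_setOf_initSeg_eq _ s).measurableSet)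
      exact (measurable_pi_apply 0 : Measurable fun v : ℕ → ℕ => v 0) (measurableSet_singleton k)
    · refine measurable_snd ?_
      exact (measurable_pi_apply (k + 1) : Measurable fun v : ℕ → ℕ => v (k + 1))
        (MeasurableSet.of_discrete (s := {a | s ∈ finsetOfNat a}))
  have hrange : range (pairCode w) = pairCode w '' T := by
    refine (image_subset_range _ _).antisymm' ?_
    rintro _ ⟨⟨y, r⟩, rfl⟩
    by_cases h : (y, r) ∈ T
    · exact ⟨_, h, rfl⟩
    · refine ⟨(y, twist (w y) r), ?_, (pairCode_eq_iff hw).2 (Or.inr rfl)⟩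
      exact fun h' => h ((initSeg_mem_twist_iff _ _).1 h')
  rw [hrange]
  refine hT.image_of_continuousOn_injOn (continuous_pairCode w).continuousOn ?_
  rintro ⟨y, r⟩ hr ⟨y', r'⟩ hr' h
  obtain rfl : y = y' := by
    simpa only [pairBase_pairCode] using congrArg pairBase h
  rcases (pairCode_eq_iff hw).1 h with rfl | rfl
  · rfl
  · exact absurd ((initSeg_mem_twist_iff _ _).2 hr') hr

/-- The sequence with first term `a` followed by `v`. -/
def seqCons (a : ℕ) (v : ℕ → ℕ) : ℕ → ℕ := fun n => n.casesOn a v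

theorem seqCons_injective (a : ℕ) : Function.Injective (seqCons a) :=
  fun _ _ h => funext fun n => congrFun h (n + 1)

theorem continuous_seqCons (a : ℕ) : Continuous (seqCons a) :=
  continuous_pi fun n => match n with
    | 0 => continuous_const
    | n + 1 => continuous_apply n

theorem eq_seqCons_iff {a : ℕ} {u v : ℕ → ℕ} :
    v = seqCons a u ↔ v 0 = a ∧ (fun n => v (n + 1)) = u := by
  constructor
  · rintro rfl
    exact ⟨rfl, rfl⟩
  · rintro ⟨rfl, rfl⟩
    funext n
    cases n <;> rfl

/-- The set whose section at a value `x` of `pairCode w` consists of the preimages of `x`, and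
whose section at any other point consists of two copies of the value of `c`. -/
def pairSet (w c : (ℕ → Bool) → ℕ → ℕ) : Set ((ℕ → Bool) × (ℕ → ℕ)) :=
  {q | (q.2 0 = 0 ∧ pairCode w (pairBase q.1, fun n => q.2 (n + 1)) = q.1) ∨
    ((q.2 0 = 1 ∨ q.2 0 = 2) ∧ (fun n => q.2 (n + 1)) = c q.1 ∧ q.2 1 = 0)}

theorem isClosed_pairSet (w : (ℕ → Bool) → ℕ → ℕ) {c : (ℕ → Bool) → ℕ → ℕ}
    (hc : IsClosed {q : (ℕ → Bool) × (ℕ → ℕ) | q.2 = c q.1}) : IsClosed (pairSet w c) := by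
  have htail : Continuous fun q : (ℕ → Bool) × (ℕ → ℕ) => fun n => q.2 (n + 1) := by fun_prop
  have hcoord : ∀ i a, IsClosed {q : (ℕ → Bool) × (ℕ → ℕ) | q.2 i = a} := fun i a =>
    isClosed_eq (by fun_prop) continuous_const
  refine .union (.inter (hcoord 0 0) ?_) (.inter ((hcoord 0 1).union (hcoord 0 2)) (.inter ?_
    (hcoord 1 0)))
  · exact isClosed_eq ((continuous_pairCode w).comp
      ((continuous_pairBase.comp continuous_fst).prodMk htail)) continuous_fst
  · exact hc.preimage (continuous_fst.prodMk htail)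

theorem section_pairSet {w c : (ℕ → Bool) → ℕ → ℕ}
    (hw : IsClosed {q : (ℕ → Bool) × (ℕ → ℕ) | q.2 = w q.1})
    (hc : ∀ x, c x 0 = 0 ↔ x ∉ range (pairCode w)) (x : ℕ → Bool) :
    ∃ u v, u ≠ v ∧ {z | (x, z) ∈ pairSet w c} = {u, v} := by
  by_cases hx : x ∈ range (pairCode w)
  · obtain ⟨⟨y, r⟩, rfl⟩ := hx
    refine ⟨seqCons 0 r, seqCons 0 (twist (w y) r),
      (seqCons_injective 0).ne (twist_ne _ _).symm, ?_⟩
    ext z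
    have h0 : ¬ ((fun n => z (n + 1)) = c (pairCode w (y, r)) ∧ z 1 = 0) := by
      rintro ⟨h1, h2⟩
      exact (hc _).1 ((congrFun h1 0).symm.trans h2) ⟨_, rfl⟩
    simp only [pairSet, mem_ofPred_eq, mem_insert_iff, mem_singleton_iff, eq_seqCons_iff,
      pairBase_pairCode, pairCode_eq_iff hw, h0]
    tauto
  · refine ⟨seqCons 1 (c x), seqCons 2 (c x), fun h => by simpa [seqCons] using congrFun h 0, ?_⟩
    ext z
    have h0 : pairCode w (pairBase x, fun n => z (n + 1)) ≠ x := fun h => hx ⟨_, h⟩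
    have h1 : (fun n => z (n + 1)) = c x → z 1 = 0 := fun h =>
      (congrFun h 0).trans ((hc x).2 hx)
    simp only [pairSet, mem_ofPred_eq, mem_insert_iff, mem_singleton_iff, eq_seqCons_iff, h0]
    tauto

/-- If `A` is comeagre in a cylinder which is invariant under `twist v`, then `A` contains a pair
of points exchanged by `twist v`. -/
theorem exists_mem_twist_mem {v : ℕ → ℕ} {t : List ℕ} (ht : t.length ≤ v 0) {A : Set (ℕ → ℕ)}
    (hA : IsMeagre (baireCylinder t \ A)) : ∃ r, r ∈ A ∧ twist v r ∈ A := by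
  have hA' : IsMeagre (twist v ⁻¹' (baireCylinder t \ A)) :=
    hA.preimage_of_isOpenMap (continuous_twist v) (twistHomeomorph v).isOpenMap
  by_contra! h
  refine not_isMeagre_of_isOpen (isOpen_baireCylinder t) (nonempty_baireCylinder t)
    ((hA.union hA').mono fun r hr => ?_)
  by_cases hrA : r ∈ A
  · exact Or.inr ⟨twist_mem_baireCylinder ht hr, h r hrA⟩
  · exact Or.inl ⟨hr, hrA⟩

end

/-- For every countable ordinal `α ≥ 1` there is a closed set `F ⊆ 2^ω × ω^ω` with all
sections two-point sets which cannot be covered by countably many `Σ⁰_α` sets with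
at most one-point sections. -/
theorem no_bound_in_Luzin_Novikov
    (α : Ordinal) (hα1 : 1 ≤ α) (hα2 : α < (Cardinal.aleph 1).ord) :
    ∃ F : Set ((ℕ → Bool) × (ℕ → ℕ)),
      IsClosed F ∧
      (∀ x : ℕ → Bool, ∃ y z : ℕ → ℕ, y ≠ z ∧ {v : ℕ → ℕ | (x, v) ∈ F} = {y, z}) ∧
      ¬ ∃ B : ℕ → Set ((ℕ → Bool) × (ℕ → ℕ)),
          (∀ n : ℕ, B n ⊆ F) ∧ (⋃ n, B n) = F ∧
          (∀ n : ℕ, B n ∈ Sigma0 ((ℕ → Bool) × (ℕ → ℕ)) α) ∧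
          (∀ (n : ℕ) (x : ℕ → Bool), {y : ℕ → ℕ | (x, y) ∈ B n}.Subsingleton) := by
  obtain ⟨n, hn, hcov⟩ := exists_measurable_comeagre_cylinder α hα2
  obtain ⟨w, hw, hw0⟩ := hn.hasClosedGraphCode
  obtain ⟨c, hc, hc0⟩ := ((measurable_const (a := 1)).indicator
    (measurableSet_range_pairCode hw)).hasClosedGraphCode
  have hcx : ∀ x, c x 0 = 0 ↔ x ∉ Set.range (pairCode w) := fun x => by
    rw [hc0, Set.indicator_apply_eq_zero]
    simp
  refine ⟨pairSet w c, isClosed_pairSet w hc, section_pairSet hw hcx, ?_⟩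
  rintro ⟨B, -, hBU, hBα, hBs⟩
  have hcont : Continuous fun q : (ℕ → Bool) × (ℕ → ℕ) => (pairCode w q, seqCons 0 q.2) :=
    (continuous_pairCode w).prodMk ((continuous_seqCons 0).comp continuous_snd)
  obtain ⟨y, k, t, ht, hm⟩ := hcov _ (fun k => Sigma0.preimage hcont α (hBα k)) fun q => by
    have : (pairCode w q, seqCons 0 q.2) ∈ pairSet w c := by
      refine Or.inl ⟨rfl, ?_⟩
      rw [pairBase_pairCode]
      rfl
    rw [← hBU] at this
    obtain ⟨k, hk⟩ := Set.mem_iUnion.1 this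
    exact ⟨k, hk⟩
  obtain ⟨r, hr, hr'⟩ := exists_mem_twist_mem (v := w y) (by rw [ht, hw0]) hm
  have htw : pairCode w (y, twist (w y) r) = pairCode w (y, r) :=
    (pairCode_eq_iff hw).2 (Or.inr rfl)
  change (pairCode w (y, twist (w y) r), seqCons 0 (twist (w y) r)) ∈ B k at hr'
  rw [htw] at hr'
  exact twist_ne (w y) r (seqCons_injective 0 (hBs k _ hr' hr))
end

section
/- For every ordinal α with 1 ≤ α < ω₁ there exists a compact set K ⊆ 2^ω × 2^ω such that for every x ∈ 2^ω the section K_x is countable, and there is no sequence (B(n))_{n∈ℕ} of subsets of K with ⋃_{n∈ℕ} B(n) = K such that each B(n) belongs to the additive Borel class Σ⁰_α(2^ω × 2^ω) and for every n ∈ ℕ and every x ∈ 2^ω the section B(n)_x contains at most one point. -/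
namespace LuzinNovikov

universe u

/-- One instruction of a construction of finite level trees: return to level `k`, with the
priority ordinal number `idx`, and use `F` as the set of nodes of the next level. -/
structure Instr where
  k : ℕ
  idx : ℕ
  F : Finset ℕ

/-- The condition (list of instructions, newest first) to which `i` returns. -/
def target (i : Instr) (u : List Instr) : List Instr := u.drop (u.length - i.k)

/-- `u` extends `v` without an injury of priority at most `γ`. -/
inductive Le (e : ℕ → Ordinal.{u}) (γ : Ordinal.{u}) (v : List Instr) : List Instr → Prop
  | refl : Le e γ v v
  | low {i : Instr} {u : List Instr} : γ < e i.idx → Le e γ v u → Le e γ v (i :: u)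
  | ret {i : Instr} {u : List Instr} : e i.idx ≤ γ → Le e γ v (target i u) → Le e γ v (i :: u)

/-- `Node e γ u s`: the number `s < 2 ^ u.length`, read as a binary sequence, is a node of
the last level of `u` which is alive at the ordinal `γ`. -/
inductive Node (e : ℕ → Ordinal.{u}) (γ : Ordinal.{u}) : List Instr → ℕ → Prop
  | nil : Node e γ [] 0
  | low {i : Instr} {u : List Instr} {s : ℕ} :
      γ < e i.idx → Node e γ u s → Node e γ (i :: u) s
  | new {i : Instr} {u : List Instr} {s : ℕ} : γ < e i.idx → s ∈ i.F → Node e γ (i :: u) s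
  | ret {i : Instr} {u : List Instr} {s : ℕ} : e i.idx ≤ γ → s ∈ i.F →
      Node e γ (target i u) (s % 2 ^ i.k) → Node e γ (i :: u) s

/-- The instruction `i` may be appended to the condition `u`. -/
structure Legal (e : ℕ → Ordinal.{u}) (α : Ordinal.{u}) (i : Instr) (u : List Instr) : Prop where
  k_le : i.k ≤ u.length
  idx_le : i.idx ≤ i.k
  le_target : Le e (e i.idx) (target i u) u
  lt_of_mem : ∀ s ∈ i.F, s < 2 ^ (u.length + 1)
  node_of_mem : ∀ s ∈ i.F, Node e (e i.idx) u (s % 2 ^ u.length)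
  node_target_of_mem : ∀ s ∈ i.F, Node e (e i.idx) (target i u) (s % 2 ^ i.k)
  exists_mem : ∀ t, Node e (e i.idx) (target i u) t → ∃ s ∈ i.F, s % 2 ^ i.k = t
  card_le : i.F.card ≤ 2 ^ i.k + 1
  eq_or_node : ∀ s ∈ i.F, ∀ s' ∈ i.F, s % 2 ^ i.k = s' % 2 ^ i.k →
    s = s' ∨ Node e α (target i u) (s % 2 ^ i.k)
  exists_pair : ∃ p q, ∀ s ∈ i.F, Node e α (target i u) (s % 2 ^ i.k) → s = p ∨ s = q

/-- Conditions all of whose instructions are legal. -/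
def Good (e : ℕ → Ordinal.{u}) (α : Ordinal.{u}) : List Instr → Prop
  | [] => True
  | i :: u => Good e α u ∧ Legal e α i u

section Conditions

variable {e : ℕ → Ordinal.{u}} {α γ γ' : Ordinal.{u}} {i : Instr} {u v w : List Instr} {s t : ℕ}

theorem target_suffix (i : Instr) (u : List Instr) : target i u <:+ u := List.drop_suffix _ _

theorem length_target (h : i.k ≤ u.length) : (target i u).length = i.k := by
  simp [target]; omega

theorem target_eq (h : v <:+ u) (hk : i.k = v.length) : target i u = v := by
  rw [target, hk]
  exact (List.suffix_iff_eq_drop.1 h).symm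

theorem Good.of_suffix (hu : Good e α u) (h : v <:+ u) : Good e α v := by
  induction u with
  | nil => rw [List.suffix_nil.1 h]; trivial
  | cons i u ih =>
    rcases List.suffix_cons_iff.1 h with rfl | h
    · exact hu
    · exact ih hu.1 h

theorem Good.target (hu : Good e α u) : Good e α (target i u) := hu.of_suffix (target_suffix i u)

theorem Le.trans (h : Le e γ u v) (h' : Le e γ v w) : Le e γ u w := by
  induction h' with
  | refl => exact h
  | low hi _ ih => exact .low hi ih
  | ret hi _ ih => exact .ret hi ih

theorem Le.suffix (h : Le e γ u v) : u <:+ v := by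
  induction h with
  | refl => exact List.suffix_rfl
  | low _ _ ih => exact ih.trans (List.suffix_cons _ _)
  | ret _ _ ih => exact (ih.trans (target_suffix _ _)).trans (List.suffix_cons _ _)

theorem Node.lt (h : Node e γ u s) (hu : Good e α u) : s < 2 ^ u.length := by
  induction h with
  | nil => simp
  | low _ _ ih => exact (ih hu.1).trans_le (Nat.pow_le_pow_right two_pos (by simp))
  | new _ hs => exact hu.2.lt_of_mem _ hs
  | ret _ hs _ _ => exact hu.2.lt_of_mem _ hs

theorem Node.anti (h : Node e γ' u s) (hγ : γ ≤ γ') : Node e γ u s := by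
  induction h with
  | nil => exact .nil
  | low hi _ ih => exact .low (hγ.trans_lt hi) ih
  | new hi hs => exact .new (hγ.trans_lt hi) hs
  | @ret i _ _ _ hs _ ih =>
    rcases le_or_gt (e i.idx) γ with h | h
    · exact .ret h hs ih
    · exact .new h hs

theorem Le.anti (h : Le e γ' v u) (hu : Good e α u) (hγ : γ ≤ γ') : Le e γ v u := by
  induction hn : u.length using Nat.strong_induction_on generalizing u v γ γ' with
  | _ n ih =>
    subst hn
    cases h with
    | refl => exact .refl
    | low hi h => exact .low (hγ.trans_lt hi) (ih _ (by simp) h hu.1 hγ rfl)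
    | @ret i u hi h =>
      have h' := ih _ (by simp [length_target hu.2.k_le, Nat.lt_succ_of_le hu.2.k_le]) h
        hu.1.target hγ rfl
      rcases le_or_gt (e i.idx) γ with hi' | hi'
      · exact .ret hi' h'
      · exact .low hi' (h'.trans (ih _ (by simp) hu.2.le_target hu.1 hi'.le rfl))

theorem Good.nil_le (hu : Good e α u) : Le e γ [] u := by
  induction hn : u.length using Nat.strong_induction_on generalizing u with
  | _ n ih =>
    subst hn
    cases u with
    | nil => exact .refl
    | cons i u =>
      rcases le_or_gt (e i.idx) γ with hi | hi
      · exact .ret hi (ih _ (by simp [length_target hu.2.k_le, Nat.lt_succ_of_le hu.2.k_le])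
          hu.1.target rfl)
      · exact .low hi (ih _ (by simp) hu.1 rfl)

theorem Node.survive (ht : Node e γ v t) (h : Le e γ v u) (hu : Good e α u) :
    ∃ s, Node e γ u s ∧ s % 2 ^ v.length = t := by
  induction h with
  | refl => exact ⟨t, ht, Nat.mod_eq_of_lt (ht.lt hu)⟩
  | low hi _ ih =>
    obtain ⟨s, hs, hst⟩ := ih hu.1
    exact ⟨s, .low hi hs, hst⟩
  | @ret i u hi h ih =>
    obtain ⟨s', hs', hst⟩ := ih hu.1.target
    obtain ⟨s, hs, hss'⟩ := hu.2.exists_mem _ (hs'.anti hi)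
    refine ⟨s, .ret hi hs (hss' ▸ hs'), ?_⟩
    rw [← hst, ← hss', Nat.mod_mod_of_dvd]
    exact pow_dvd_pow _ (length_target hu.2.k_le ▸ h.suffix.length_le)

theorem Good.exists_pair (hu : Good e α u) (he : ∀ n, e n < α) :
    ∃ p q, ∀ s, Node e α u s → s = p ∨ s = q := by
  cases u with
  | nil => exact ⟨0, 0, fun s hs => by cases hs; simp⟩
  | cons i u =>
    obtain ⟨p, q, h⟩ := hu.2.exists_pair
    refine ⟨p, q, fun s hs => ?_⟩
    cases hs with
    | low hi => exact absurd hi (he _).not_gt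
    | new hi => exact absurd hi (he _).not_gt
    | ret _ hs hs' => exact h s hs hs'

theorem Node.zero_tail (h : Node e 0 (i :: u) s) (hu : Good e α (i :: u)) :
    Node e 0 u (s % 2 ^ u.length) := by
  cases h with
  | low _ h => rwa [Nat.mod_eq_of_lt (h.lt hu.1)]
  | new _ hs => exact (hu.2.node_of_mem _ hs).anti bot_le
  | ret _ hs _ => exact (hu.2.node_of_mem _ hs).anti bot_le

/-- At most one node of the last level of `v` is alive at `α`. -/
def Uniq (e : ℕ → Ordinal.{u}) (α : Ordinal.{u}) (v : List Instr) : Prop :=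
  ∀ s s', Node e α v s → Node e α v s' → s = s'

theorem exists_cons_of_le (he : ∀ n, e n < α) (hv : Good e α v) (hu : Good e α u) {j t' : ℕ}
    (hj : j ≤ v.length) (hvu : Le e (e j) v u) (ht : Node e α v t) (ht' : Node e (e j) u t')
    (htt' : t' % 2 ^ v.length = t) :
    ∃ i : Instr, Good e α (i :: u) ∧ Le e α v (i :: u) ∧ (∀ γ < e j, Le e γ u (i :: u)) ∧
      Node e α (i :: u) t' ∧ (Uniq e α v → Uniq e α (i :: u)) := by
  classical
  have hsurv : ∀ r, ∃ s, Node e (e j) v r → Node e (e j) u s ∧ s % 2 ^ v.length = r := by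
    intro r
    by_cases hr : Node e (e j) v r
    · obtain ⟨s, hs⟩ := hr.survive hvu hu
      exact ⟨s, fun _ => hs⟩
    · exact ⟨0, fun h => absurd h hr⟩
  choose g hg using hsurv
  let f := Function.update g t t'
  have hft : f t = t' := Function.update_self ..
  have hf : ∀ r, Node e (e j) v r → Node e (e j) u (f r) ∧ f r % 2 ^ v.length = r := by
    intro r hr
    rcases eq_or_ne r t with rfl | hrt
    · rw [hft]; exact ⟨ht', htt'⟩
    · have : f r = g r := Function.update_of_ne hrt ..
      rw [this]; exact hg r hr
  let F : Finset ℕ := ((Finset.range (2 ^ v.length)).filter (Node e (e j) v)).image f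
  have hF : ∀ s, s ∈ F ↔ ∃ r, Node e (e j) v r ∧ f r = s := by
    intro s
    simp only [F, Finset.mem_image, Finset.mem_filter, Finset.mem_range]
    exact ⟨fun ⟨r, hr, h⟩ => ⟨r, hr.2, h⟩, fun ⟨r, hr, h⟩ => ⟨r, ⟨hr.lt hv, hr⟩, h⟩⟩
  let i : Instr := ⟨v.length, j, F⟩
  have htar : target i u = v := target_eq hvu.suffix rfl
  have htF : t' ∈ F := (hF _).2 ⟨t, ht.anti (he j).le, hft⟩
  refine ⟨i, ⟨hu, ?_⟩, .ret (he j).le (htar ▸ .refl), fun γ hγ => .low hγ .refl,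
    .ret (he j).le htF (htar ▸ htt'.symm ▸ ht), fun hun s s' hs hs' => ?_⟩
  · refine ⟨hvu.suffix.length_le, hj, htar.symm ▸ hvu, fun s hs => ?_, fun s hs => ?_,
      fun s hs => ?_, fun r hr => ?_, ?_, fun s hs s' hs' h => ?_, ?_⟩
    · obtain ⟨r, hr, rfl⟩ := (hF s).1 hs
      exact ((hf r hr).1.lt hu).trans_le (Nat.pow_le_pow_right two_pos (by simp))
    · obtain ⟨r, hr, rfl⟩ := (hF s).1 hs
      rw [Nat.mod_eq_of_lt ((hf r hr).1.lt hu)]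
      exact (hf r hr).1
    · obtain ⟨r, hr, rfl⟩ := (hF s).1 hs
      rw [htar, (hf r hr).2]
      exact hr
    · rw [htar] at hr
      exact ⟨f r, (hF _).2 ⟨r, hr, rfl⟩, (hf r hr).2⟩
    · calc F.card ≤ _ := Finset.card_image_le
        _ ≤ (Finset.range (2 ^ v.length)).card := Finset.card_filter_le _ _
        _ ≤ 2 ^ v.length + 1 := by simp
    · obtain ⟨r, hr, rfl⟩ := (hF s).1 hs
      obtain ⟨r', hr', rfl⟩ := (hF s').1 hs'
      change f r % 2 ^ v.length = f r' % 2 ^ v.length at h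
      rw [(hf r hr).2, (hf r' hr').2] at h
      exact .inl (h ▸ rfl)
    · obtain ⟨p, q, hpq⟩ := hv.exists_pair he
      refine ⟨f p, f q, fun s hs h => ?_⟩
      obtain ⟨r, hr, rfl⟩ := (hF s).1 hs
      rw [htar] at h
      change Node e α v (f r % 2 ^ v.length) at h
      rw [(hf r hr).2] at h
      exact (hpq r h).imp (congrArg f) (congrArg f)
  · have key : ∀ s, Node e α (i :: u) s → s = t' := by
      intro s hs
      cases hs with
      | low hi => exact absurd hi (he _).not_gt
      | new hi => exact absurd hi (he _).not_gt
      | ret _ hs h =>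
        obtain ⟨r, hr, rfl⟩ := (hF s).1 hs
        rw [htar] at h
        change Node e α v (f r % 2 ^ v.length) at h
        rw [(hf r hr).2] at h
        rw [hun _ _ h ht, hft]
    rw [key s hs, key s' hs']

theorem exists_split (he : ∀ n, e n < α) (hv : Good e α v) (ht : Node e α v t)
    (hun : Uniq e α v) :
    ∃ i : Instr, Good e α (i :: v) ∧ Le e α v (i :: v) ∧ Node e α (i :: v) t ∧
      Node e α (i :: v) (t + 2 ^ v.length) := by
  classical
  let F : Finset ℕ := insert (t + 2 ^ v.length)
    ((Finset.range (2 ^ v.length)).filter (Node e (e 0) v))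
  have htlt := ht.lt hv
  have hF : ∀ s, s ∈ F ↔ s = t + 2 ^ v.length ∨ Node e (e 0) v s := by
    intro s
    simp only [F, Finset.mem_insert, Finset.mem_filter, Finset.mem_range]
    exact or_congr_right ⟨fun h => h.2, fun h => ⟨h.lt hv, h⟩⟩
  have hmod : (t + 2 ^ v.length) % 2 ^ v.length = t := by
    rw [Nat.add_mod_right, Nat.mod_eq_of_lt htlt]
  have hnode : ∀ s ∈ F, Node e (e 0) v (s % 2 ^ v.length) := by
    intro s hs
    rcases (hF s).1 hs with rfl | h
    · rw [hmod]; exact ht.anti (he 0).le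
    · rwa [Nat.mod_eq_of_lt (h.lt hv)]
  have hcase : ∀ s ∈ F, s = t + 2 ^ v.length ∨ s % 2 ^ v.length = s := by
    intro s hs
    exact ((hF s).1 hs).imp_right fun h => Nat.mod_eq_of_lt (h.lt hv)
  let i : Instr := ⟨v.length, 0, F⟩
  have htar : target i v = v := target_eq List.suffix_rfl rfl
  have h1 : t ∈ F := (hF _).2 (.inr (ht.anti (he 0).le))
  have h2 : t + 2 ^ v.length ∈ F := (hF _).2 (.inl rfl)
  refine ⟨i, ⟨hv, ?_⟩, .ret (he 0).le (by rw [htar]; exact .refl), .ret (he 0).le h1 ?_,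
    .ret (he 0).le h2 ?_⟩
  · refine ⟨le_rfl, Nat.zero_le _, htar.symm ▸ .refl, fun s hs => ?_, hnode, ?_, fun r hr => ?_, ?_,
      fun s hs s' hs' h => ?_, ?_⟩
    · rw [pow_succ]
      rcases (hF s).1 hs with rfl | h
      · omega
      · have := h.lt hv
        omega
    · rw [htar]; exact hnode
    · rw [htar] at hr
      exact ⟨r, (hF _).2 (.inr hr), Nat.mod_eq_of_lt (hr.lt hv)⟩
    · refine (Finset.card_insert_le _ _).trans (Nat.succ_le_succ ?_)
      exact (Finset.card_filter_le _ _).trans (by simp [i])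
    · rw [htar]
      change s % 2 ^ v.length = s' % 2 ^ v.length at h
      change s = s' ∨ Node e α v (s % 2 ^ v.length)
      rcases hcase s hs with rfl | h1
      · exact .inr (hmod.symm ▸ ht)
      · rcases hcase s' hs' with rfl | h2
        · rw [h, hmod]; exact .inr ht
        · exact .inl (by rw [← h1, h, h2])
    · refine ⟨t, t + 2 ^ v.length, fun s hs h => ?_⟩
      rw [htar] at h
      rcases hcase s hs with rfl | h1
      · exact .inr rfl
      · refine .inl ?_
        rw [← h1]
        exact hun _ _ h ht
  · rw [htar]
    change Node e α v (t % 2 ^ v.length)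
    rwa [Nat.mod_eq_of_lt htlt]
  · rw [htar]
    change Node e α v ((t + 2 ^ v.length) % 2 ^ v.length)
    rwa [hmod]

end Conditions

/-- The condition made of the first `n` instructions of `I`. -/
def pre (I : ℕ → Instr) : ℕ → List Instr
  | 0 => []
  | n + 1 => I n :: pre I n

/-- The first `n` bits of `y`, read as a natural number. -/
def num (y : ℕ → Bool) : ℕ → ℕ
  | 0 => 0
  | n + 1 => num y n + if y n then 2 ^ n else 0

section Branches

theorem length_pre (I : ℕ → Instr) (n : ℕ) : (pre I n).length = n := by
  induction n with
  | zero => rfl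
  | succ n ih => simp [pre, ih]

theorem pre_suffix (I : ℕ → Instr) {k n : ℕ} (h : k ≤ n) : pre I k <:+ pre I n := by
  induction n, h using Nat.le_induction with
  | base => exact List.suffix_rfl
  | succ n _ ih => exact ih.trans (List.suffix_cons _ _)

theorem pre_congr {I J : ℕ → Instr} {n : ℕ} (h : ∀ k < n, I k = J k) : pre I n = pre J n := by
  induction n with
  | zero => rfl
  | succ n ih => rw [pre, pre, h n n.lt_succ_self, ih fun k hk => h k (hk.trans n.lt_succ_self)]

theorem num_lt (y : ℕ → Bool) (n : ℕ) : num y n < 2 ^ n := by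
  induction n with
  | zero => simp [num]
  | succ n ih => rw [num, pow_succ]; split_ifs <;> omega

theorem num_mod (y : ℕ → Bool) {k n : ℕ} (h : k ≤ n) : num y n % 2 ^ k = num y k := by
  induction n, h using Nat.le_induction with
  | base => exact Nat.mod_eq_of_lt (num_lt y k)
  | succ n hn ih =>
    rw [num]
    split_ifs
    · rw [Nat.add_mod, Nat.mod_eq_zero_of_dvd (pow_dvd_pow 2 hn), ih, Nat.add_zero,
        Nat.mod_eq_of_lt (num_lt y k)]
    · exact ih

theorem num_congr {x y : ℕ → Bool} {n : ℕ} (h : ∀ k < n, x k = y k) : num x n = num y n := by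
  induction n with
  | zero => rfl
  | succ n ih => rw [num, num, h n n.lt_succ_self, ih fun k hk => h k (hk.trans n.lt_succ_self)]

theorem apply_eq_of_num_eq {x y : ℕ → Bool} {n k : ℕ} (h : num x n = num y n) (hk : k < n) : x k = y k := by
  have h1 : num x (k + 1) = num y (k + 1) := by rw [← num_mod x hk, ← num_mod y hk, h]
  have h0 : num x k = num y k := by rw [← num_mod x hk.le, ← num_mod y hk.le, h]
  rw [num, num, h0] at h1
  have := Nat.two_pow_pos k
  cases hx : x k <;> cases hy : y k <;> simp [hx, hy] at h1 ⊢

theorem eq_of_num_eq {x y : ℕ → Bool} {N : Set ℕ} (hN : N.Infinite)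
    (h : ∀ n ∈ N, num x n = num y n) : x = y := by
  funext k
  obtain ⟨n, hn, hkn⟩ := hN.exists_gt k
  exact apply_eq_of_num_eq (h n hn) hkn

theorem finite_of_card_le {N : Set ℕ} (hN : N.Infinite) {G : ℕ → Finset ℕ} {M : ℕ}
    (hG : ∀ n ∈ N, (G n).card ≤ M) : {y : ℕ → Bool | ∀ n ∈ N, num y n ∈ G n}.Finite := by
  by_contra hinf
  obtain ⟨T, hT, hcard⟩ := Set.Infinite.exists_subset_card_eq hinf (M + 1)
  have hsep : ∀ x y : ℕ → Bool, ∃ k, x ≠ y → x k ≠ y k := by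
    intro x y
    by_cases h : x = y
    · exact ⟨0, fun h' => absurd h h'⟩
    · obtain ⟨k, hk⟩ := Function.ne_iff.1 h
      exact ⟨k, fun _ => hk⟩
  choose k hk using hsep
  obtain ⟨n, hn, hlt⟩ := hN.exists_gt ((T ×ˢ T).sup fun p => k p.1 p.2)
  have hinj : Set.InjOn (fun y => num y n) (T : Set (ℕ → Bool)) := by
    intro x hx y hy hxy
    by_contra hne
    refine hk x y hne (apply_eq_of_num_eq hxy (lt_of_le_of_lt ?_ hlt))
    exact Finset.le_sup (f := fun p : (ℕ → Bool) × (ℕ → Bool) => k p.1 p.2)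
      (Finset.mk_mem_product hx hy)
  have := Finset.card_le_card_of_injOn (fun y => num y n)
    (fun y hy => hT hy n hn) hinj
  have := hG n hn
  omega

variable {e : ℕ → Ordinal.{u}} {α γ γ' : Ordinal.{u}} {I : ℕ → Instr} {j k m n : ℕ}

theorem le_cons_iff {i : Instr} {u v : List Instr} : Le e γ v (i :: u) ↔
    v = i :: u ∨ (γ < e i.idx ∧ Le e γ v u) ∨ (e i.idx ≤ γ ∧ Le e γ v (target i u)) := by
  constructor
  · intro h
    cases h with
    | refl => exact .inl rfl
    | low h h' => exact .inr (.inl ⟨h, h'⟩)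
    | ret h h' => exact .inr (.inr ⟨h, h'⟩)
  · rintro (rfl | ⟨h, h'⟩ | ⟨h, h'⟩)
    exacts [.refl, .low h h', .ret h h']

theorem node_cons_iff {i : Instr} {u : List Instr} {s : ℕ} : Node e γ (i :: u) s ↔
    (γ < e i.idx ∧ (Node e γ u s ∨ s ∈ i.F)) ∨
      (e i.idx ≤ γ ∧ s ∈ i.F ∧ Node e γ (target i u) (s % 2 ^ i.k)) := by
  constructor
  · intro h
    cases h with
    | low h h' => exact .inl ⟨h, .inl h'⟩
    | new h h' => exact .inl ⟨h, .inr h'⟩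
    | ret h h' h'' => exact .inr ⟨h, h', h''⟩
  · rintro (⟨h, h' | h'⟩ | ⟨h, h', h''⟩)
    exacts [.low h h', .new h h', .ret h h' h'']

/-- `Le` between two initial segments of `I`. -/
def L (e : ℕ → Ordinal.{u}) (I : ℕ → Instr) (γ : Ordinal.{u}) (k n : ℕ) : Prop :=
  Le e γ (pre I k) (pre I n)

theorem L.le (h : L e I γ k n) : k ≤ n := by
  have := h.suffix.length_le
  rwa [length_pre, length_pre] at this

theorem L.trans (h : L e I γ j k) (h' : L e I γ k n) : L e I γ j n := Le.trans h h'

theorem target_pre (hI : ∀ n, Good e α (pre I n)) (m : ℕ) :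
    (I m).k ≤ m ∧ target (I m) (pre I m) = pre I (I m).k := by
  have h : (I m).k ≤ m := by
    have := (hI (m + 1)).2.k_le
    rwa [length_pre] at this
  exact ⟨h, target_eq (pre_suffix I h) (length_pre _ _).symm⟩

theorem L_succ_iff (hI : ∀ n, Good e α (pre I n)) : L e I γ j (m + 1) ↔
    j = m + 1 ∨ (γ < e (I m).idx ∧ L e I γ j m) ∨ (e (I m).idx ≤ γ ∧ L e I γ j (I m).k) := by
  rw [L, pre, le_cons_iff, (target_pre hI m).2]
  refine or_congr_left ⟨fun h => ?_, ?_⟩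
  · have := congrArg List.length h
    simpa [length_pre] using this
  · rintro rfl; rfl

theorem node_succ_iff (hI : ∀ n, Good e α (pre I n)) {s : ℕ} : Node e γ (pre I (m + 1)) s ↔
    (γ < e (I m).idx ∧ (Node e γ (pre I m) s ∨ s ∈ (I m).F)) ∨
      (e (I m).idx ≤ γ ∧ s ∈ (I m).F ∧ Node e γ (pre I (I m).k) (s % 2 ^ (I m).k)) := by
  rw [pre, node_cons_iff, (target_pre hI m).2]

theorem node_of_mem (hI : ∀ n, Good e α (pre I n)) {s : ℕ} (hs : s ∈ (I m).F) :
    Node e (e (I m).idx) (pre I m) (s % 2 ^ m) := by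
  have := (hI (m + 1)).2.node_of_mem s hs
  rwa [length_pre] at this

theorem L_target (hI : ∀ n, Good e α (pre I n)) (m : ℕ) : L e I (e (I m).idx) (I m).k m := by
  have := (hI (m + 1)).2.le_target
  rwa [(target_pre hI m).2] at this

theorem L_target_succ (hI : ∀ n, Good e α (pre I n)) (γ : Ordinal.{u}) (m : ℕ) :
    L e I γ (I m).k (m + 1) := by
  rcases le_or_gt (e (I m).idx) γ with h | h
  · exact (L_succ_iff hI).2 (.inr (.inr ⟨h, .refl⟩))
  · exact (L_succ_iff hI).2 (.inr (.inl ⟨h, Le.anti (L_target hI m) (hI m) h.le⟩))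

/-- The levels of `I` which are never injured by priorities below `γ`, hereditarily. -/
def Stable (e : ℕ → Ordinal.{u}) (I : ℕ → Instr) (γ : Ordinal.{u}) : Set ℕ :=
  {k | ∀ (γ' : Ordinal.{u}) (_ : γ' < γ), k ∈ Stable e I γ' ∧
    ∀ n ∈ Stable e I γ', k ≤ n → L e I γ' k n}
termination_by γ

theorem mem_stable : k ∈ Stable e I γ ↔
    ∀ γ' < γ, k ∈ Stable e I γ' ∧ ∀ n ∈ Stable e I γ', k ≤ n → L e I γ' k n := by
  rw [Stable]; rfl

theorem stable_anti (h : γ ≤ γ') : Stable e I γ' ⊆ Stable e I γ := by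
  intro k hk
  rcases h.eq_or_lt with rfl | h
  · exact hk
  · exact (mem_stable.1 hk γ h).1

theorem stable_zero : Stable e I 0 = Set.univ :=
  Set.eq_univ_of_forall fun _ => mem_stable.2 fun γ' h => absurd h (not_lt_bot (a := γ'))

theorem zero_mem_stable (hI : ∀ n, Good e α (pre I n)) (γ : Ordinal.{u}) :
    0 ∈ Stable e I γ := by
  induction γ using WellFoundedLT.induction with
  | _ γ ih => exact mem_stable.2 fun γ' h => ⟨ih γ' h, fun n _ _ => (hI n).nil_le⟩

theorem L_of_mem_stable (hk : k ∈ Stable e I γ) (hγ : γ' < γ) (hn : n ∈ Stable e I γ')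
    (hkn : k ≤ n) : L e I γ' k n := (mem_stable.1 hk γ' hγ).2 n hn hkn

/-- Going one step down from a stable level to an earlier one. -/
def Descends (e : ℕ → Ordinal.{u}) (I : ℕ → Instr) (γ : Ordinal.{u}) (n m : ℕ) : Prop :=
  (γ ≤ e (I m).idx ∧ m ∈ Stable e I γ) ∨
    (e (I m).idx < γ ∧ (I m).k ∈ Stable e I γ ∧ n ≤ (I m).k)

theorem descends_of_forall (hI : ∀ n, Good e α (pre I n))
    (h : ∀ {j n}, n ∈ Stable e I γ → (∀ γ' < γ, L e I γ' j n) → j ∈ Stable e I γ)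
    (hn : n ∈ Stable e I γ) (hm : m + 1 ∈ Stable e I γ) (hnm : n < m + 1) :
    Descends e I γ n m := by
  rcases le_or_gt γ (e (I m).idx) with hγ | hγ
  · refine .inl ⟨hγ, h hm fun γ' hγ' => ?_⟩
    exact (L_succ_iff hI).2 (.inr (.inl ⟨hγ'.trans_le hγ, .refl⟩))
  · refine .inr ⟨hγ, h hm fun γ' _ => L_target_succ hI γ' m, ?_⟩
    rcases (L_succ_iff hI).1 (L_of_mem_stable hn hγ (stable_anti hγ.le hm) hnm.le) with
      h | ⟨h, _⟩ | ⟨_, h⟩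
    · omega
    · exact absurd h (lt_irrefl _)
    · exact h.le

theorem L_of_descends (hI : ∀ n, Good e α (pre I n))
    (h : ∀ {n m}, n ∈ Stable e I γ → m + 1 ∈ Stable e I γ → n < m + 1 → Descends e I γ n m) {n' : ℕ}
    (hn : n ∈ Stable e I γ) (hn' : n' ∈ Stable e I γ) (hnn' : n ≤ n') (hj : L e I γ j n')
    (hjn : j ≤ n) : L e I γ j n := by
  induction n' using Nat.strong_induction_on with
  | _ n' ih =>
    rcases hnn'.eq_or_lt with rfl | hlt
    · exact hj
    obtain ⟨m, rfl⟩ : ∃ m, n' = m + 1 := ⟨n' - 1, by omega⟩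
    have hk := (target_pre hI m).1
    rcases h hn hn' hlt with ⟨hγ, hm⟩ | ⟨hγ, hm, hnk⟩
    · refine ih m m.lt_succ_self hm (Nat.le_of_lt_succ hlt) ?_
      rcases (L_succ_iff hI).1 hj with h | ⟨_, h⟩ | ⟨h', h⟩
      · omega
      · exact h
      · obtain rfl := le_antisymm hγ h'
        exact h.trans (L_target hI m)
    · refine ih _ (Nat.lt_succ_of_le hk) hm hnk ?_
      rcases (L_succ_iff hI).1 hj with h | ⟨h, _⟩ | ⟨_, h⟩
      · omega
      · exact absurd h hγ.not_gt
      · exact h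

theorem mem_stable_of_L (hI : ∀ n, Good e α (pre I n)) (hn : n ∈ Stable e I γ)
    (h : ∀ γ' < γ, L e I γ' j n) : j ∈ Stable e I γ := by
  induction γ using WellFoundedLT.induction generalizing j n with
  | _ γ ih =>
    refine mem_stable.2 fun δ hδ => ⟨ih δ hδ (stable_anti hδ.le hn) fun γ' h' =>
      h γ' (h'.trans hδ), fun m hm hjm => ?_⟩
    rcases le_total m n with hmn | hmn
    · exact L_of_descends hI (descends_of_forall hI (ih δ hδ)) hm (stable_anti hδ.le hn) hmn
        (h δ hδ) hjm
    · exact (h δ hδ).trans (L_of_mem_stable hn hδ hm hmn)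

theorem descends (hI : ∀ n, Good e α (pre I n)) (hn : n ∈ Stable e I γ)
    (hm : m + 1 ∈ Stable e I γ) (hnm : n < m + 1) : Descends e I γ n m :=
  descends_of_forall hI (mem_stable_of_L hI) hn hm hnm

theorem L_of_stable (hI : ∀ n, Good e α (pre I n)) {n' : ℕ}
    (hn : n ∈ Stable e I γ) (hn' : n' ∈ Stable e I γ) (hnn' : n ≤ n') (hj : L e I γ j n')
    (hjn : j ≤ n) : L e I γ j n := L_of_descends hI (descends hI) hn hn' hnn' hj hjn

theorem target_mem_stable (hI : ∀ n, Good e α (pre I n)) (hm : m + 1 ∈ Stable e I γ) :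
    (I m).k ∈ Stable e I γ :=
  mem_stable_of_L hI hm fun γ' _ => L_target_succ hI γ' m

theorem node_of_stable (hI : ∀ n, Good e α (pre I n)) {n' s : ℕ}
    (hn : n ∈ Stable e I γ) (hn' : n' ∈ Stable e I γ) (hnn' : n ≤ n')
    (hs : Node e γ (pre I n') s) : Node e γ (pre I n) (s % 2 ^ n) := by
  induction n' using Nat.strong_induction_on generalizing s with
  | _ n' ih =>
    rcases hnn'.eq_or_lt with rfl | hlt
    · have := hs.lt (hI n)
      rw [length_pre] at this
      rwa [Nat.mod_eq_of_lt this]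
    obtain ⟨m, rfl⟩ : ∃ m, n' = m + 1 := ⟨n' - 1, by omega⟩
    have hk := (target_pre hI m).1
    rcases descends hI hn hn' hlt with ⟨hγ, hm⟩ | ⟨hγ, hm, hnk⟩
    · have hnm := Nat.le_of_lt_succ hlt
      have key : s ∈ (I m).F → Node e γ (pre I n) (s % 2 ^ n) := fun h => by
        have := ih m m.lt_succ_self hm hnm ((node_of_mem hI h).anti hγ)
        rwa [Nat.mod_mod_of_dvd _ (pow_dvd_pow 2 hnm)] at this
      rcases (node_succ_iff hI).1 hs with ⟨_, h | h⟩ | ⟨_, h, _⟩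
      · exact ih m m.lt_succ_self hm hnm h
      · exact key h
      · exact key h
    · rcases (node_succ_iff hI).1 hs with ⟨h, _⟩ | ⟨_, _, h⟩
      · exact absurd h hγ.not_gt
      · have := ih _ (Nat.lt_succ_of_le hk) hm hnk h
        rwa [Nat.mod_mod_of_dvd _ (pow_dvd_pow 2 hnk)] at this

theorem eq_of_not_node (hI : ∀ n, Good e α (pre I n)) (hγ : γ ≤ α)
    (hinf : (Stable e I γ).Infinite) {y y' : ℕ → Bool}
    (hy₀ : ∀ n, Node e 0 (pre I n) (num y n)) (hy₀' : ∀ n, Node e 0 (pre I n) (num y' n))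
    (hy : ∀ δ < γ, ∀ n ∈ Stable e I δ, Node e δ (pre I n) (num y n))
    (hy' : ∀ δ < γ, ∀ n ∈ Stable e I δ, Node e δ (pre I n) (num y' n))
    (hn : n ∈ Stable e I γ) (hyn : num y n = num y' n) (hnot : ¬ Node e γ (pre I n) (num y n)) :
    y = y' := by
  refine eq_of_num_eq (N := Stable e I γ ∩ Set.Ici n) ?_ ?_
  · refine Set.infinite_of_forall_exists_gt fun a => ?_
    obtain ⟨b, hb, hab⟩ := hinf.exists_gt (max a n)
    exact ⟨b, ⟨hb, (le_max_right _ _).trans hab.le⟩, (le_max_left _ _).trans_lt hab⟩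
  rintro n' ⟨hn', hnn'⟩
  rw [Set.mem_Ici] at hnn'
  induction n' using Nat.strong_induction_on with
  | _ n' ih =>
    rcases hnn'.eq_or_lt with rfl | hlt
    · exact hyn
    obtain ⟨m, rfl⟩ : ∃ m, n' = m + 1 := ⟨n' - 1, by omega⟩
    have hk := (target_pre hI m).1
    rcases descends hI hn hn' hlt with ⟨hγm, hm⟩ | ⟨hγm, hm, hnk⟩
    · have hnm := Nat.le_of_lt_succ hlt
      have heq := ih m m.lt_succ_self hm hnm
      have key : ∀ z : ℕ → Bool, num z n = num y n → (∀ n, Node e 0 (pre I n) (num z n)) →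
          num z (m + 1) = num z m := by
        intro z hzn hz
        have hF : num z (m + 1) ∉ (I m).F := fun h => by
          have h1 := (node_of_mem hI h).anti hγm
          rw [num_mod z m.le_succ] at h1
          have h2 := node_of_stable hI hn hm hnm h1
          rw [num_mod z hnm, hzn] at h2
          exact hnot h2
        rcases (node_succ_iff hI).1 (hz (m + 1)) with ⟨_, h | h⟩ | ⟨_, h, _⟩
        · have := h.lt (hI m)
          rw [length_pre] at this
          rw [← num_mod z m.le_succ, Nat.mod_eq_of_lt this]
        · exact absurd h hF
        · exact absurd h hF
      rw [key y rfl hy₀, key y' hyn.symm hy₀', heq]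
    · have heq := ih _ (Nat.lt_succ_of_le hk) hm hnk
      have key : ∀ z : ℕ → Bool,
          (∀ δ < γ, ∀ n ∈ Stable e I δ, Node e δ (pre I n) (num z n)) →
          num z (m + 1) ∈ (I m).F := by
        intro z hz
        rcases (node_succ_iff hI).1 (hz _ hγm (m + 1) (stable_anti hγm.le hn')) with
          ⟨h, _⟩ | ⟨_, h, _⟩
        · exact absurd h (lt_irrefl _)
        · exact h
      have hk' := hk.trans m.le_succ
      rcases (hI (m + 1)).2.eq_or_node _ (key y hy) _ (key y' hy')
        (by rw [num_mod y hk', num_mod y' hk', heq]) with h | h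
      · exact h
      · rw [(target_pre hI m).2, num_mod y hk'] at h
        have h2 := node_of_stable hI hn hm hnk (h.anti hγ)
        rw [num_mod y hnk] at h2
        exact absurd h2 hnot

theorem infinite_stable_of_isSuccLimit (hI : ∀ n, Good e α (pre I n)) (hγ : Order.IsSuccLimit γ)
    (hinf : ∀ δ < γ, (Stable e I δ).Infinite) : (Stable e I γ).Infinite := by
  suffices h : ∀ k ∈ Stable e I γ, ∃ k' ∈ Stable e I γ, k < k' by
    intro hfin
    obtain ⟨k, hk, hmax⟩ := Set.exists_max_image _ id hfin ⟨0, zero_mem_stable hI γ⟩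
    obtain ⟨k', hk', hlt⟩ := h k hk
    exact absurd (hmax k' hk') (not_le.2 hlt)
  intro k hk
  obtain ⟨γ₀, hγ₀, hbound⟩ : ∃ γ₀ < γ, ∀ j ≤ k, e j < γ → e j < γ₀ := by
    clear hk
    induction k with
    | zero =>
      by_cases h : e 0 < γ
      · exact ⟨Order.succ (e 0), hγ.succ_lt h, fun j hj _ => by
          rw [Nat.le_zero.1 hj]; exact Order.lt_succ _⟩
      · exact ⟨0, zero_le.lt_of_ne fun h => hγ.1 (h ▸ isMin_bot), fun j hj hj' => by
          rw [Nat.le_zero.1 hj] at hj'; exact absurd hj' h⟩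
    | succ k ih =>
      obtain ⟨γ₀, h0, h1⟩ := ih
      by_cases h : e (k + 1) < γ
      · refine ⟨max γ₀ (Order.succ (e (k + 1))), max_lt h0 (hγ.succ_lt h), fun j hj hj' => ?_⟩
        rcases Nat.le_succ_iff.1 hj with hj | rfl
        · exact (h1 j hj hj').trans_le (le_max_left _ _)
        · exact (Order.lt_succ _).trans_le (le_max_right _ _)
      · refine ⟨γ₀, h0, fun j hj hj' => ?_⟩
        rcases Nat.le_succ_iff.1 hj with hj | rfl
        · exact h1 j hj hj'
        · exact absurd hj' h
  classical
  have hex : ∃ k', k' ∈ Stable e I γ₀ ∧ k < k' := (hinf γ₀ hγ₀).exists_gt k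
  obtain ⟨hk₀, hkk'⟩ := Nat.find_spec hex
  have hmin : ∀ n ∈ Stable e I γ₀, k < n → Nat.find hex ≤ n := fun n hn h =>
    Nat.find_min' hex ⟨hn, h⟩
  generalize Nat.find hex = k' at hk₀ hkk' hmin
  have claim : ∀ δ, γ₀ ≤ δ → δ < γ → ∀ n ∈ Stable e I δ, k < n →
      k' ∈ Stable e I δ ∧ L e I δ k' n := by
    intro δ hδ₀ hδ n
    induction n using Nat.strong_induction_on with
    | _ n ih =>
      intro hn hkn
      have hkn' := hmin n (stable_anti hδ₀ hn) hkn
      rcases hkn'.eq_or_lt with rfl | hlt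
      · exact ⟨hn, .refl⟩
      obtain ⟨m, rfl⟩ : ∃ m, n = m + 1 := ⟨n - 1, by omega⟩
      have hk := (target_pre hI m).1
      have hidx : (I m).idx ≤ (I m).k := (hI (m + 1)).2.idx_le
      rcases descends hI (stable_anti hδ.le ‹k ∈ Stable e I γ›) hn hkn with
        ⟨hδm, hm⟩ | ⟨hδm, hm, _⟩
      · obtain ⟨h1, h2⟩ := ih m m.lt_succ_self hm (by omega)
        refine ⟨h1, ?_⟩
        rcases hδm.eq_or_lt with heq | hδm
        · have hkm : k < (I m).k := by
            by_contra hle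
            have := hbound (I m).idx (by omega) (heq ▸ hδ)
            exact absurd hδ₀ (heq ▸ this).not_ge
          exact (L_succ_iff hI).2 (.inr (.inr ⟨heq.ge, (ih _ (Nat.lt_succ_of_le hk)
            (target_mem_stable hI hn) hkm).2⟩))
        · exact (L_succ_iff hI).2 (.inr (.inl ⟨hδm, h2⟩))
      · have hkm : k < (I m).k := by
          by_contra hle
          have hlt₀ := hbound (I m).idx (by omega) (hδm.trans hδ)
          rcases descends hI hk₀ (stable_anti hδ₀ hn) hlt with ⟨h, _⟩ | ⟨_, _, h⟩
          · exact absurd hlt₀ h.not_gt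
          · omega
        obtain ⟨h1, h2⟩ := ih _ (Nat.lt_succ_of_le hk) hm hkm
        exact ⟨h1, (L_succ_iff hI).2 (.inr (.inr ⟨hδm.le, h2⟩))⟩
  refine ⟨k', mem_stable.2 fun δ hδ => ?_, hkk'⟩
  rcases lt_or_ge δ γ₀ with h | h
  · exact mem_stable.1 hk₀ δ h
  · obtain ⟨n, hn, hkn⟩ := (hinf δ hδ).exists_gt k
    exact ⟨(claim δ h hδ n hn hkn).1, fun n hn hn' => (claim δ h hδ n hn (hkk'.trans_le hn')).2⟩

theorem bounded_or_infinite_stable_succ (hI : ∀ n, Good e α (pre I n))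
    (hinf : (Stable e I γ).Infinite) :
    (∃ K, {n | n ∈ Stable e I γ ∧ ∃ m, n = m + 1 ∧ e (I m).idx = γ ∧ (I m).k ≤ K}.Infinite) ∨
      (Stable e I (Order.succ γ)).Infinite := by
  classical
  by_contra! hcon
  obtain ⟨hfin, hfin'⟩ := hcon
  obtain ⟨N, hN⟩ : ∃ N, ∀ n ∈ Stable e I (Order.succ γ), n ≤ N := by
    obtain ⟨N, hN⟩ := hfin'.bddAbove
    exact ⟨N, fun n hn => hN hn⟩
  obtain ⟨n₁, hn₁⟩ : ∃ n₁, ∀ m, m + 1 ∈ Stable e I γ → e (I m).idx = γ → (I m).k ≤ N →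
      m + 1 ≤ n₁ := by
    obtain ⟨n₁, h⟩ := (hfin N).bddAbove
    exact ⟨n₁, fun m h1 h2 h3 => h ⟨h1, m, rfl, h2, h3⟩⟩
  have hex : ∃ p, ∃ n ∈ Stable e I γ, max n₁ N < n ∧ L e I γ p n ∧ N < p ∧
      (p = n ∨ ∃ m, n = m + 1 ∧ e (I m).idx = γ ∧ p = (I m).k) := by
    obtain ⟨n, hn, h⟩ := hinf.exists_gt (max n₁ N)
    exact ⟨n, n, hn, h, .refl, (le_max_right _ _).trans_lt h, .inl rfl⟩
  obtain ⟨a, ha, hna, hpa, hNp, hpcase⟩ := Nat.find_spec hex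
  have hmin : ∀ m, m + 1 ∈ Stable e I γ → max n₁ N < m + 1 → e (I m).idx = γ →
      Nat.find hex ≤ (I m).k := by
    intro m hm hm1 hm2
    refine Nat.find_min' hex ⟨m + 1, hm, hm1, L_target_succ hI γ m, ?_, .inr ⟨m, rfl, hm2, rfl⟩⟩
    by_contra h
    have := hn₁ m hm hm2 (not_lt.1 h)
    exact absurd ((le_max_left _ _).trans_lt hm1) this.not_gt
  generalize Nat.find hex = p at hpa hNp hpcase hmin
  have hp : p ∈ Stable e I γ := by
    rcases hpcase with rfl | ⟨m, rfl, _, rfl⟩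
    · exact ha
    · exact target_mem_stable hI ha
  have claim : ∀ n ∈ Stable e I γ, p ≤ n → L e I γ p n := by
    intro n
    induction n using Nat.strong_induction_on with
    | _ n ih =>
      intro hn hpn
      rcases le_or_gt n a with hle | hlt
      · exact L_of_stable hI hn ha hle hpa hpn
      obtain ⟨m, rfl⟩ : ∃ m, n = m + 1 := ⟨n - 1, by omega⟩
      have hk := (target_pre hI m).1
      have hpa' := hpa.le
      rcases descends hI ha hn hlt with ⟨hγm, hm⟩ | ⟨hγm, hm, hak⟩
      · rcases hγm.eq_or_lt with heq | hγm
        · exact (L_succ_iff hI).2 (.inr (.inr ⟨heq.ge, ih _ (Nat.lt_succ_of_le hk)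
            (target_mem_stable hI hn) (hmin m hn (hna.trans hlt) heq.symm)⟩))
        · exact (L_succ_iff hI).2 (.inr (.inl ⟨hγm, ih m m.lt_succ_self hm (by omega)⟩))
      · exact (L_succ_iff hI).2 (.inr (.inr ⟨hγm.le, ih _ (Nat.lt_succ_of_le hk) hm
          (hpa'.trans hak)⟩))
  refine absurd (hN p (mem_stable.2 fun δ hδ => ?_)) hNp.not_ge
  rcases (Order.lt_succ_iff.1 hδ).eq_or_lt with rfl | hδ
  · exact ⟨hp, claim⟩
  · exact mem_stable.1 hp δ hδ

theorem exists_finite_stable (he : ∀ n, e n < α) (hI : ∀ n, Good e α (pre I n)) :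
    ∃ γ ≤ α, (Stable e I γ).Infinite ∧
      {y : ℕ → Bool | ∀ n ∈ Stable e I γ, Node e γ (pre I n) (num y n)}.Finite := by
  classical
  by_cases hα : (Stable e I α).Infinite
  · refine ⟨α, le_rfl, hα, ?_⟩
    have hpair := fun n => (hI n).exists_pair he
    choose p q hpq using hpair
    refine (finite_of_card_le hα (G := fun n => {p n, q n}) (M := 2)
      fun n _ => Finset.card_le_two).subset fun y hy n hn => ?_
    simpa using hpq n _ (hy n hn)
  · obtain ⟨γ₁, hγ₁, hmin⟩ : ∃ γ₁, ¬ (Stable e I γ₁).Infinite ∧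
        ∀ δ < γ₁, (Stable e I δ).Infinite := by
      have := WellFounded.has_min (wellFounded_lt (α := Ordinal.{u}))
        {γ | ¬ (Stable e I γ).Infinite} ⟨α, hα⟩
      obtain ⟨γ₁, h1, h2⟩ := this
      exact ⟨γ₁, h1, fun δ hδ => by_contra fun h => h2 δ h hδ⟩
    have hle : γ₁ ≤ α := not_lt.1 fun h => hα (hmin α h)
    rcases Ordinal.zero_or_succ_or_isSuccLimit γ₁ with rfl | ⟨γ, rfl⟩ | hlim
    · exact absurd (stable_zero (e := e) (I := I) ▸ Set.infinite_univ) hγ₁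
    · have hlt : γ < Order.succ γ := Order.lt_succ γ
      refine ⟨γ, hlt.le.trans hle, hmin γ hlt, ?_⟩
      rcases bounded_or_infinite_stable_succ hI (hmin γ hlt) with ⟨K, hK⟩ | h
      · refine (finite_of_card_le hK (G := fun n => (I (n - 1)).F) (M := 2 ^ K + 1) ?_).subset ?_
        · rintro _ ⟨_, m, rfl, _, hk⟩
          have := (hI (m + 1)).2.card_le
          simp only [Nat.add_sub_cancel]
          exact this.trans (Nat.succ_le_succ (Nat.pow_le_pow_right two_pos hk))
        · rintro y hy _ ⟨hm, m, rfl, hγ, _⟩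
          rcases (node_succ_iff hI).1 (hy _ hm) with ⟨h, _⟩ | ⟨_, h, _⟩
          · exact absurd h hγ.le.not_gt
          · exact h
      · exact absurd h hγ₁
    · exact absurd (infinite_stable_of_isSuccLimit hI hlim hmin) hγ₁

theorem countable_branches (he : ∀ n, e n < α) (hα : (Set.Iic α).Countable)
    (hI : ∀ n, Good e α (pre I n)) :
    {y : ℕ → Bool | ∀ n, Node e 0 (pre I n) (num y n)}.Countable := by
  obtain ⟨γ, hγ, hinf, hfin⟩ := exists_finite_stable he hI
  have hcount : (⋃ δ ∈ Set.Iic α, ⋃ n : ℕ, ⋃ t : ℕ, {y : ℕ → Bool | δ ≤ γ ∧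
      (∀ n, Node e 0 (pre I n) (num y n)) ∧
      (∀ δ' < δ, ∀ n ∈ Stable e I δ', Node e δ' (pre I n) (num y n)) ∧
      n ∈ Stable e I δ ∧ num y n = t ∧ ¬ Node e δ (pre I n) (num y n)}).Countable := by
    refine hα.biUnion fun δ hδ => Set.countable_iUnion fun n => Set.countable_iUnion fun t => ?_
    refine Set.Subsingleton.countable ?_
    rintro y ⟨hδγ, h1, h2, h3, h4, h5⟩ y' ⟨_, h1', h2', _, h4', _⟩
    exact eq_of_not_node hI hδ (hinf.mono (stable_anti hδγ)) h1 h1' h2 h2' h3 (h4.trans h4'.symm) h5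
  refine (hfin.countable.union hcount).mono fun y hy => ?_
  by_cases hy' : ∀ n ∈ Stable e I γ, Node e γ (pre I n) (num y n)
  · exact .inl hy'
  · right
    obtain ⟨δ, h1, h2⟩ := WellFounded.has_min (wellFounded_lt (α := Ordinal.{u}))
      {δ | ¬ ∀ n ∈ Stable e I δ, Node e δ (pre I n) (num y n)} ⟨γ, hy'⟩
    have hδγ : δ ≤ γ := not_lt.1 (h2 γ hy')
    have h1' : ¬ ∀ n ∈ Stable e I δ, Node e δ (pre I n) (num y n) := h1
    push Not at h1'
    obtain ⟨n, hn, hnot⟩ := h1'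
    simp only [Set.mem_iUnion]
    exact ⟨δ, hδγ.trans hγ, n, num y n, hδγ, hy, fun δ' hδ' => by_contra fun h => h2 δ' h hδ',
      hn, rfl, hnot⟩

end Branches

instance : TopologicalSpace Instr := ⊥

instance : DiscreteTopology Instr := ⟨rfl⟩

/-- Codes of Borel subsets of `Z`. -/
inductive Code (Z : Type) : Type (u + 1)
  | op (O : Set Z) : Code Z
  | un (β : Ordinal.{u}) (C : ℕ → Code Z) : Code Z

namespace Code

variable {Z : Type}

/-- The additive class of a code. -/
def rank : Code.{u} Z → Ordinal.{u}
  | op _ => 1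
  | un β _ => β

/-- The set coded by a code. -/
def carrier : Code.{u} Z → Set Z
  | op O => O
  | un _ C => ⋃ n, (C n).carrierᶜ

/-- A code is valid if it follows the definition of the additive classes. -/
def Valid [TopologicalSpace Z] : Code.{u} Z → Prop
  | op O => IsOpen O
  | un β C => 1 < β ∧ ∀ n, (C n).Valid ∧ (C n).rank < β

/-- The subcode at a position; positions beyond a leaf denote the leaf. -/
def sub : Code.{u} Z → List ℕ → Code.{u} Z
  | c, [] => c
  | op O, _ :: _ => op O
  | un _ C, m :: p => (C m).sub p

theorem Valid.one_le_rank [TopologicalSpace Z] {c : Code.{u} Z} (hc : c.Valid) : 1 ≤ c.rank := by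
  cases c with
  | op O => exact le_rfl
  | un β C => exact hc.1.le

theorem Valid.sub [TopologicalSpace Z] {c : Code.{u} Z} (hc : c.Valid) (p : List ℕ) :
    (c.sub p).Valid ∧ (c.sub p).rank ≤ c.rank := by
  induction c generalizing p with
  | op O => cases p <;> exact ⟨hc, le_rfl⟩
  | un β C ih =>
    cases p with
    | nil => exact ⟨hc, le_rfl⟩
    | cons m p =>
      obtain ⟨h1, h2⟩ := ih m (hc.2 m).1 p
      exact ⟨h1, h2.trans (hc.2 m).2.le⟩

end Code

theorem exists_code {Y : Type*} [TopologicalSpace Y] {Z : Type} [TopologicalSpace Z] {φ : Z → Y}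
    (hφ : Continuous φ) {β : Ordinal.{u}} {S : Set Y} (hS : S ∈ Sigma0 Y β) :
    ∃ c : Code.{u} Z, c.Valid ∧ c.rank = β ∧ c.carrier = φ ⁻¹' S := by
  induction β using WellFoundedLT.induction generalizing S with
  | _ β ih =>
    rw [Sigma0] at hS
    rcases hS with ⟨rfl, hS⟩ | ⟨hβ, A, b, hA, rfl⟩
    · exact ⟨.op (φ ⁻¹' S), hS.preimage hφ, rfl, rfl⟩
    · choose h1 hb hA using hA
      choose C hC hr hs using fun n => ih (b n) (hb n) (hA n)
      refine ⟨.un β C, ⟨hβ, fun n => ⟨hC n, (hr n).trans_lt (hb n)⟩⟩, rfl, ?_⟩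
      simp [Code.carrier, hs]

/-- Pairs of a sequence of instructions and a binary sequence. -/
abbrev Branch : Type := (ℕ → Instr) × (ℕ → Bool)

/-- The basic open set of all branches passing through the node `s` of `u`. -/
def cyl (u : List Instr) (s : ℕ) : Set Branch :=
  {z | pre z.1 u.length = u ∧ num z.2 u.length = s}

/-- The node `t` of `v` forces the complement of the set coded by a code. -/
def Neg (e : ℕ → Ordinal.{u}) (α : Ordinal.{u}) : Code.{u} Branch → List Instr → ℕ → Prop
  | .op O, v, t => ∀ u s, Good e α u → Le e 1 v u → Node e 1 u s → s % 2 ^ v.length = t →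
      ¬ cyl u s ⊆ O
  | .un β C, v, t => ∀ u s, Good e α u → Le e β v u → Node e β u s → s % 2 ^ v.length = t →
      ¬ ∃ n, Neg e α (C n) u s

/-- The node `t` of `v` witnesses membership in the set coded by a code. -/
def Wit (e : ℕ → Ordinal.{u}) (α : Ordinal.{u}) : Code.{u} Branch → List Instr → ℕ → Prop
  | .op O, v, t => cyl v t ⊆ O
  | .un _ C, v, t => ∃ n, Neg e α (C n) v t

/-- The node `t` of `v` decides membership in the set coded by `c`. -/
def Decided (e : ℕ → Ordinal.{u}) (α : Ordinal.{u}) (c : Code.{u} Branch) (v : List Instr)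
    (t : ℕ) : Prop := Neg e α c v t ∨ Wit e α c v t

section Forcing

variable {e : ℕ → Ordinal.{u}} {α γ : Ordinal.{u}} {u v w : List Instr} {s t t' : ℕ}
  {c : Code.{u} Branch}

theorem neg_iff : Neg e α c v t ↔ ∀ u s, Good e α u → Le e c.rank v u → Node e c.rank u s →
    s % 2 ^ v.length = t → ¬ Wit e α c u s := by
  cases c <;> rfl

theorem mod_trans (h : v <:+ w) (hs : s % 2 ^ w.length = t') (ht : t' % 2 ^ v.length = t) :
    s % 2 ^ v.length = t := by
  rw [← ht, ← hs, Nat.mod_mod_of_dvd _ (pow_dvd_pow 2 h.length_le)]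

theorem Neg.mono (h : Neg e α c v t) (hvw : Le e c.rank v w) (ht : t' % 2 ^ v.length = t) :
    Neg e α c w t' := by
  rw [neg_iff] at h ⊢
  exact fun u s hu hwu hs hst => h u s hu (hvw.trans hwu) hs (mod_trans hvw.suffix hst ht)

theorem cyl_subset (h : v <:+ w) (ht : t' % 2 ^ v.length = t) : cyl w t' ⊆ cyl v t := by
  rintro z ⟨h1, h2⟩
  have hle := h.length_le
  constructor
  · have h3 : pre z.1 v.length <:+ w := by rw [← h1]; exact pre_suffix _ hle
    rw [List.suffix_iff_eq_drop] at h3 h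
    rw [h3, length_pre, ← h]
  · rw [← num_mod z.2 hle, h2, ht]

theorem Wit.mono (h : Wit e α c v t) (hc : c.Valid)
    (hvw : ∀ γ < c.rank, Le e γ v w) (ht : t' % 2 ^ v.length = t) : Wit e α c w t' := by
  cases c with
  | op O =>
    have h0 : Le e 0 v w := hvw 0 (show (0 : Ordinal.{u}) < 1 from zero_lt_one)
    exact (cyl_subset h0.suffix ht).trans h
  | un β C =>
    obtain ⟨n, hn⟩ := h
    exact ⟨n, hn.mono (hvw _ (hc.2 n).2) ht⟩

theorem Decided.mono (h : Decided e α c v t) (hc : c.Valid) (hcα : c.rank < α) (hw : Good e α w)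
    (hvw : Le e α v w) (ht : t' % 2 ^ v.length = t) : Decided e α c w t' :=
  h.imp (fun h => h.mono (hvw.anti hw hcα.le) ht)
    fun h => h.mono hc (fun _ hγ => hvw.anti hw (hγ.trans hcα).le) ht

/-- The node `t'` of `w` properly extends the node `t` of `v`, with no injury. -/
structure Ext (e : ℕ → Ordinal.{u}) (α : Ordinal.{u}) (v : List Instr) (t : ℕ) (w : List Instr)
    (t' : ℕ) : Prop where
  good : Good e α w
  lt : v.length < w.length
  le : Le e α v w
  node : Node e α w t'
  mod : t' % 2 ^ v.length = t
  uniq : Uniq e α v → Uniq e α w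

theorem Ext.trans (h : Ext e α v t w t') (h' : Ext e α w t' u s) : Ext e α v t u s :=
  ⟨h'.good, h.lt.trans h'.lt, h.le.trans h'.le, h'.node, mod_trans h.le.suffix h'.mod h.mod,
    fun hu => h'.uniq (h.uniq hu)⟩

theorem exists_ext_length (he : ∀ n, e n < α) (hv : Good e α v) (ht : Node e α v t) (n : ℕ) :
    ∃ w t', Ext e α v t w t' ∧ n ≤ w.length := by
  have step : ∀ {v t}, Good e α v → Node e α v t → ∃ w t', Ext e α v t w t' := by
    intro v t hv ht
    have hmod := Nat.mod_eq_of_lt (ht.lt hv)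
    obtain ⟨i, h1, h2, _, h4, h5⟩ := exists_cons_of_le he hv hv (Nat.zero_le _) .refl ht
      (ht.anti (he 0).le) hmod
    exact ⟨i :: v, t, h1, by simp, h2, h4, hmod, h5⟩
  induction n with
  | zero =>
    obtain ⟨w, t', h⟩ := step hv ht
    exact ⟨w, t', h, Nat.zero_le _⟩
  | succ n ih =>
    obtain ⟨w, t', h, hn⟩ := ih
    obtain ⟨w', t'', h'⟩ := step h.good h.node
    exact ⟨w', t'', h.trans h', hn.trans_lt h'.lt⟩

theorem exists_decided (he : ∀ n, e n < α) (hsurj : ∀ β, 1 ≤ β → β < α → ∃ j, e j = β)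
    (hv : Good e α v) (ht : Node e α v t) (hc : c.Valid) (hcα : c.rank < α) :
    ∃ w t', Ext e α v t w t' ∧ Decided e α c w t' := by
  obtain ⟨j, hj⟩ := hsurj _ hc.one_le_rank hcα
  obtain ⟨w, t', hw, hjw⟩ := exists_ext_length he hv ht j
  by_cases hneg : Neg e α c w t'
  · exact ⟨w, t', hw, .inl hneg⟩
  rw [neg_iff] at hneg
  push Not at hneg
  obtain ⟨u, s, hu, hwu, hs, hst, hwit⟩ := hneg
  rw [← hj] at hwu hs
  obtain ⟨i, h1, h2, h3, h4, h5⟩ := exists_cons_of_le he hw.good hu hjw hwu hw.node hs hst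
  refine ⟨i :: u, s, hw.trans ⟨h1, Nat.lt_succ_of_le hwu.suffix.length_le, h2, h4, hst, h5⟩,
    .inr (hwit.mono hc (hj ▸ h3) (Nat.mod_eq_of_lt (hs.lt hu)))⟩

theorem exists_decided_pair (he : ∀ n, e n < α) (hsurj : ∀ β, 1 ≤ β → β < α → ∃ j, e j = β)
    (hv : Good e α v) (ht : Node e α v t) (ht' : Node e α v t') (hc : c.Valid)
    (hcα : c.rank < α) :
    ∃ w s s', Ext e α v t w s ∧ Ext e α v t' w s' ∧ Decided e α c w s ∧ Decided e α c w s' := by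
  obtain ⟨w, s, h, hd⟩ := exists_decided he hsurj hv ht hc hcα
  obtain ⟨s', hs', hst'⟩ := ht'.survive h.le h.good
  have h' : Ext e α v t' w s' := ⟨h.good, h.lt, h.le, hs', hst', h.uniq⟩
  obtain ⟨w₁, r', hr', hd'⟩ := exists_decided he hsurj h.good hs' hc hcα
  obtain ⟨r, hr, hsr⟩ := h.node.survive hr'.le hr'.good
  have h₁ : Ext e α w s w₁ r := ⟨hr'.good, hr'.lt, hr'.le, hr, hsr, hr'.uniq⟩
  exact ⟨w₁, r, r', h.trans h₁, h'.trans hr', hd.mono hc hcα h₁.good h₁.le h₁.mod, hd'⟩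

theorem exists_pre_eq {l : ℕ → List Instr} (hl : ∀ n, l n <:+ l (n + 1))
    (hlt : ∀ n, (l n).length < (l (n + 1)).length) :
    ∃ I : ℕ → Instr, ∀ n, pre I (l n).length = l n := by
  have hmono : StrictMono fun n => (l n).length := strictMono_nat_of_lt_succ hlt
  have hsuff : ∀ {a b}, a ≤ b → l a <:+ l b := by
    intro a b h
    induction b, h using Nat.le_induction with
    | base => exact List.suffix_rfl
    | succ b _ ih => exact ih.trans (hl b)
  have hpre : ∀ l' : List Instr, pre (fun m => l'.reverse.getD m ⟨0, 0, ∅⟩) l'.length = l' := by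
    intro l'
    induction l' with
    | nil => rfl
    | cons i l' ih =>
      rw [List.length_cons, pre]
      congr 1
      · simp
      · refine Eq.trans (pre_congr fun k hk => ?_) ih
        rw [List.reverse_cons, List.getD_append _ _ _ _ (by simpa using hk)]
  refine ⟨fun m => (l (m + 1)).reverse.getD m ⟨0, 0, ∅⟩, fun n => ?_⟩
  refine Eq.trans (pre_congr fun k hk => ?_) (hpre (l n))
  have key : ∀ {a b}, a ≤ b → k < (l a).length →
      (l b).reverse.getD k ⟨0, 0, ∅⟩ = (l a).reverse.getD k ⟨0, 0, ∅⟩ := by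
    intro a b hab ha
    obtain ⟨r, hr⟩ := hsuff hab
    rw [← hr, List.reverse_append, List.getD_append _ _ _ _ (by simpa using ha)]
  have hk1 : k < (l (k + 1)).length := hmono.le_apply (x := k + 1)
  rcases le_total n (k + 1) with h | h
  · exact key h hk
  · exact (key h hk1).symm

theorem num_testBit (t n : ℕ) : num (fun m => t.testBit m) n = t % 2 ^ n := by
  induction n with
  | zero => simp [num, Nat.mod_one]
  | succ n ih =>
    rw [num, ih, Nat.mod_pow_succ, Nat.testBit_eq_decide_div_mod_eq]
    rcases Nat.mod_two_eq_zero_or_one (t / 2 ^ n) with h | h <;> simp [h]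

theorem exists_num_eq {l t : ℕ → ℕ} (hl : StrictMono l) (ht : ∀ n, t (n + 1) % 2 ^ l n = t n)
    (hlt : ∀ n, t n < 2 ^ l n) : ∃ y : ℕ → Bool, ∀ n, num y (l n) = t n := by
  have hmod : ∀ {a b}, a ≤ b → t b % 2 ^ l a = t a := by
    intro a b h
    induction b, h using Nat.le_induction with
    | base => exact Nat.mod_eq_of_lt (hlt a)
    | succ b hb ih =>
      rw [← ih, ← ht b, Nat.mod_mod_of_dvd _ (pow_dvd_pow 2 (hl.monotone hb))]
  refine ⟨fun m => (t (m + 1)).testBit m, fun n => ?_⟩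
  rw [← Nat.mod_eq_of_lt (hlt n), ← num_testBit]
  refine num_congr fun k hk => ?_
  have key : ∀ {a b}, a ≤ b → k < l a → (t b).testBit k = (t a).testBit k := by
    intro a b hab ha
    rw [← hmod hab, Nat.testBit_mod_two_pow]
    simp [ha]
  have hk1 : k < l (k + 1) := hl.le_apply (x := k + 1)
  rcases le_total n (k + 1) with h | h
  · exact key h hk
  · exact (key h hk1).symm

/-- Along the levels `l`, the branch `(I, y)` is alive at `α` and never injured. -/
structure Generic (e : ℕ → Ordinal.{u}) (α : Ordinal.{u}) (I : ℕ → Instr) (y : ℕ → Bool)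
    (l : ℕ → ℕ) : Prop where
  mono : StrictMono l
  good : ∀ n, Good e α (pre I (l n))
  le : ∀ n, Le e α (pre I (l n)) (pre I (l (n + 1)))
  node : ∀ n, Node e α (pre I (l n)) (num y (l n))

theorem exists_generic (he : ∀ n, e n < α) (hsurj : ∀ β, 1 ≤ β → β < α → ∃ j, e j = β)
    (hv : Good e α v) (ht : Node e α v t) (ht' : Node e α v t') {req : ℕ → Code.{u} Branch}
    (hreq : ∀ n, (req n).Valid ∧ (req n).rank < α) :
    ∃ I y y' l, Generic e α I y l ∧ Generic e α I y' l ∧ l 0 = v.length ∧ pre I (l 0) = v ∧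
      num y (l 0) = t ∧ num y' (l 0) = t' ∧
      (∀ n, ∃ k, Decided e α (req n) (pre I (l k)) (num y (l k))) ∧
      (∀ n, ∃ k, Decided e α (req n) (pre I (l k)) (num y' (l k))) ∧
      (Uniq e α v → ∀ n, Uniq e α (pre I (l n))) := by
  let σ := {p : List Instr × ℕ × ℕ //
    Good e α p.1 ∧ Node e α p.1 p.2.1 ∧ Node e α p.1 p.2.2}
  have hstep : ∀ (n : ℕ) (x : σ), ∃ x' : σ, Ext e α x.1.1 x.1.2.1 x'.1.1 x'.1.2.1 ∧
      Ext e α x.1.1 x.1.2.2 x'.1.1 x'.1.2.2 ∧ Decided e α (req n) x'.1.1 x'.1.2.1 ∧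
      Decided e α (req n) x'.1.1 x'.1.2.2 := by
    rintro n ⟨⟨w, s, s'⟩, hw, hs, hs'⟩
    obtain ⟨w', r, r', h1, h2, h3, h4⟩ :=
      exists_decided_pair he hsurj hw hs hs' (hreq n).1 (hreq n).2
    exact ⟨⟨⟨w', r, r'⟩, h1.good, h1.node, h2.node⟩, h1, h2, h3, h4⟩
  choose f hf1 hf2 hf3 hf4 using hstep
  let x : ℕ → σ := fun n => Nat.rec ⟨⟨v, t, t'⟩, hv, ht, ht'⟩ (fun n x => f n x) n
  have hx : ∀ n, x (n + 1) = f n (x n) := fun n => rfl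
  have h1 : ∀ n, Ext e α (x n).1.1 (x n).1.2.1 (x (n + 1)).1.1 (x (n + 1)).1.2.1 :=
    fun n => hx n ▸ hf1 n (x n)
  have h2 : ∀ n, Ext e α (x n).1.1 (x n).1.2.2 (x (n + 1)).1.1 (x (n + 1)).1.2.2 :=
    fun n => hx n ▸ hf2 n (x n)
  have hl : StrictMono fun n => (x n).1.1.length := strictMono_nat_of_lt_succ fun n => (h1 n).lt
  obtain ⟨I, hI⟩ := exists_pre_eq (l := fun n => (x n).1.1) (fun n => (h1 n).le.suffix)
    fun n => (h1 n).lt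
  obtain ⟨y, hy⟩ := exists_num_eq hl (t := fun n => (x n).1.2.1) (fun n => (h1 n).mod)
    fun n => (x n).2.2.1.lt (x n).2.1
  obtain ⟨y', hy'⟩ := exists_num_eq hl (t := fun n => (x n).1.2.2) (fun n => (h2 n).mod)
    fun n => (x n).2.2.2.lt (x n).2.1
  refine ⟨I, y, y', fun n => (x n).1.1.length, ⟨hl, fun n => ?_, fun n => ?_, fun n => ?_⟩,
    ⟨hl, fun n => ?_, fun n => ?_, fun n => ?_⟩, rfl, hI 0, hy 0, hy' 0, fun n => ⟨n + 1, ?_⟩,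
    fun n => ⟨n + 1, ?_⟩, fun hv n => ?_⟩
  · exact (hI n).symm ▸ (x n).2.1
  · rw [hI n, hI (n + 1)]; exact (h1 n).le
  · rw [hI n, hy n]; exact (x n).2.2.1
  · exact (hI n).symm ▸ (x n).2.1
  · rw [hI n, hI (n + 1)]; exact (h1 n).le
  · rw [hI n, hy' n]; exact (x n).2.2.2
  · rw [hI (n + 1), hy (n + 1)]; exact hf3 n (x n)
  · rw [hI (n + 1), hy' (n + 1)]; exact hf4 n (x n)
  · rw [hI n]
    induction n with
    | zero => exact hv
    | succ n ih => exact (h1 n).uniq ih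

variable {I : ℕ → Instr} {y : ℕ → Bool} {l : ℕ → ℕ}

theorem Generic.le_of_le (h : Generic e α I y l) {a b : ℕ} (hab : a ≤ b) :
    Le e α (pre I (l a)) (pre I (l b)) := by
  induction b, hab using Nat.le_induction with
  | base => exact .refl
  | succ b _ ih => exact ih.trans (h.le b)

theorem Generic.mod_of_le (h : Generic e α I y l) {a b : ℕ} (hab : a ≤ b) :
    num y (l b) % 2 ^ (pre I (l a)).length = num y (l a) := by
  rw [length_pre, num_mod _ (h.mono.monotone hab)]

theorem Generic.good_pre (h : Generic e α I y l) (n : ℕ) : Good e α (pre I n) :=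
  (h.good n).of_suffix (pre_suffix I h.mono.le_apply)

theorem Generic.node_pre (h : Generic e α I y l) (n : ℕ) : Node e 0 (pre I n) (num y n) := by
  have key : ∀ k, Node e 0 (pre I (n + k)) (num y (n + k)) → Node e 0 (pre I n) (num y n) := by
    intro k
    induction k with
    | zero => exact id
    | succ k ih =>
      intro hk
      refine ih ?_
      have := Node.zero_tail (i := I (n + k)) (u := pre I (n + k)) hk (h.good_pre (n + k + 1))
      rwa [length_pre, ← Nat.add_assoc, num_mod y (n + k).le_succ] at this
  obtain ⟨k, hk⟩ := Nat.exists_eq_add_of_le (h.mono.le_apply (x := n))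
  exact key k (hk ▸ (h.node n).anti bot_le)

theorem exists_cyl_subset {O : Set Branch} (hO : IsOpen O) (h : (I, y) ∈ O) :
    ∃ N, ∀ n ≥ N, cyl (pre I n) (num y n) ⊆ O := by
  obtain ⟨U, V, hU, hV, hIU, hyV, hUV⟩ := isOpen_prod_iff.1 hO I y h
  obtain ⟨F, f, hf, hF⟩ := isOpen_pi_iff.1 hU I hIU
  obtain ⟨G, g, hg, hG⟩ := isOpen_pi_iff.1 hV y hyV
  refine ⟨max (F.sup id) (G.sup id) + 1, fun n hn => ?_⟩
  rintro ⟨J, z⟩ ⟨h1, h2⟩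
  rw [length_pre] at h1 h2
  refine hUV ⟨hF fun k hk => ?_, hG fun k hk => ?_⟩
  · have hkn : k < n := by
      have : k ≤ F.sup id := Finset.le_sup (f := id) hk
      have := le_max_left (F.sup id) (G.sup id)
      omega
    have h3 : pre J (k + 1) = pre I (k + 1) := by
      have hJ := List.suffix_iff_eq_drop.1 (pre_suffix J hkn)
      have hI := List.suffix_iff_eq_drop.1 (pre_suffix I hkn)
      simp only [length_pre, Nat.succ_eq_add_one] at hJ hI h1
      rw [hJ, hI, h1]
    have h4 : J k = I k := (List.cons.inj h3).1
    change J k ∈ f k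
    rw [h4]
    exact (hf k hk).2
  · have hkn : k < n := by
      have : k ≤ G.sup id := Finset.le_sup (f := id) hk
      have := le_max_right (F.sup id) (G.sup id)
      omega
    have h4 : z k = y k := apply_eq_of_num_eq h2 hkn
    change z k ∈ g k
    rw [h4]
    exact (hg k hk).2

theorem Generic.notMem_carrier_iff (h : Generic e α I y l) (hc : c.Valid) (hcα : c.rank < α)
    (hdec : ∀ p, ∃ n, Decided e α (c.sub p) (pre I (l n)) (num y (l n))) :
    (I, y) ∉ c.carrier ↔ ∃ n, Neg e α c (pre I (l n)) (num y (l n)) := by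
  induction c with
  | op O =>
    constructor
    · intro hO
      obtain ⟨n, hn | hn⟩ := hdec []
      · exact ⟨n, hn⟩
      · refine absurd (hn ⟨?_, ?_⟩) hO <;> rw [length_pre]
    · rintro ⟨n, hn⟩ hO
      obtain ⟨N, hN⟩ := exists_cyl_subset hc hO
      have hle := le_max_left n N
      refine hn _ _ (h.good _) ((h.le_of_le hle).anti (h.good _) hcα.le) ((h.node _).anti hcα.le)
        (h.mod_of_le hle) (hN _ ((le_max_right n N).trans h.mono.le_apply))
  | un β C ih =>
    have hC : ∀ m, (I, y) ∉ (C m).carrier ↔ ∃ n, Neg e α (C m) (pre I (l n)) (num y (l n)) :=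
      fun m => ih m (hc.2 m).1 ((hc.2 m).2.trans hcα) fun p => hdec (m :: p)
    constructor
    · intro hO
      obtain ⟨n, hn | ⟨m, hm⟩⟩ := hdec []
      · exact ⟨n, hn⟩
      · exact absurd (Set.mem_iUnion.2 ⟨m, (hC m).2 ⟨n, hm⟩⟩) hO
    · rintro ⟨n, hn⟩ hO
      obtain ⟨m, hm⟩ := Set.mem_iUnion.1 hO
      obtain ⟨n', hn'⟩ := (hC m).1 hm
      have hle := le_max_left n n'
      have hle' := le_max_right n n'
      refine hn _ _ (h.good _) ((h.le_of_le hle).anti (h.good _) hcα.le) ((h.node _).anti hcα.le)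
        (h.mod_of_le hle) ⟨m, hn'.mono ?_ (h.mod_of_le hle')⟩
      exact (h.le_of_le hle').anti (h.good _) ((hc.2 m).2.trans hcα).le

/-- The branches through sequences of legal instructions. -/
def branches (e : ℕ → Ordinal.{u}) (α : Ordinal.{u}) : Set Branch :=
  {z | ∀ n, Good e α (pre z.1 n) ∧ Node e 0 (pre z.1 n) (num z.2 n)}

theorem Generic.mem_branches (h : Generic e α I y l) : (I, y) ∈ branches e α :=
  fun n => ⟨h.good_pre n, h.node_pre n⟩

theorem exists_pair_notMem (he : ∀ n, e n < α) (hsurj : ∀ β, 1 ≤ β → β < α → ∃ j, e j = β)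
    {ι : Type} [Countable ι] [Nonempty ι] {c : ι → Code.{u} Branch}
    (hc : ∀ a, (c a).Valid ∧ (c a).rank < α)
    (hcov : ∀ z ∈ branches e α, ∃ a, z ∉ (c a).carrier) :
    ∃ a I y y', y ≠ y' ∧ (I, y) ∈ branches e α ∧ (I, y') ∈ branches e α ∧
      (I, y) ∉ (c a).carrier ∧ (I, y') ∉ (c a).carrier := by
  obtain ⟨g, hg⟩ := exists_surjective_nat (ι × List ℕ)
  let req : ℕ → Code.{u} Branch := fun n => (c (g n).1).sub (g n).2
  have hreq : ∀ n, (req n).Valid ∧ (req n).rank < α := fun n =>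
    ⟨((hc (g n).1).1.sub _).1, ((hc (g n).1).1.sub _).2.trans_lt (hc (g n).1).2⟩
  have hsub : ∀ {P : Code.{u} Branch → Prop}, (∀ n, P (req n)) → ∀ a p, P ((c a).sub p) := by
    intro P hP a p
    obtain ⟨n, hn⟩ := hg (a, p)
    have := hP n
    simpa only [req, hn] using this
  have huniq : Uniq e α ([] : List Instr) := by
    intro s s' hs hs'
    cases hs; cases hs'; rfl
  obtain ⟨I, y, _, l, hgen, _, _, _, _, _, hdec, _, hun⟩ :=
    exists_generic he hsurj (v := []) trivial .nil .nil hreq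
  obtain ⟨a, ha⟩ := hcov _ hgen.mem_branches
  obtain ⟨n, hn⟩ := (hgen.notMem_carrier_iff (hc a).1 (hc a).2
    (hsub (P := fun c => ∃ k, Decided e α c (pre I (l k)) (num y (l k))) hdec a)).1 ha
  obtain ⟨i, h1, h2, h3, h4⟩ := exists_split he (hgen.good n) (hgen.node n) (hun huniq n)
  obtain ⟨J, x, x', l', hgen₁, hgen₂, _, h6, h7, h8, hdec₁, hdec₂, _⟩ :=
    exists_generic he hsurj h1 h3 h4 hreq
  have hlt := num_lt y (l n)
  have hneg : ∀ s, s % 2 ^ (pre I (l n)).length = num y (l n) →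
      Neg e α (c a) (i :: pre I (l n)) s := fun s hs => hn.mono (h2.anti h1 (hc a).2.le) hs
  refine ⟨a, J, x, x', fun h => ?_, hgen₁.mem_branches, hgen₂.mem_branches, ?_, ?_⟩
  · rw [h, h8] at h7
    have := Nat.two_pow_pos (pre I (l n)).length
    omega
  · refine (hgen₁.notMem_carrier_iff (hc a).1 (hc a).2
      (hsub (P := fun c => ∃ k, Decided e α c (pre J (l' k)) (num x (l' k))) hdec₁ a)).2 ⟨0, ?_⟩
    rw [h6, h7]
    exact hneg _ (by rw [length_pre, Nat.mod_eq_of_lt hlt])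
  · refine (hgen₂.notMem_carrier_iff (hc a).1 (hc a).2
      (hsub (P := fun c => ∃ k, Decided e α c (pre J (l' k)) (num x' (l' k))) hdec₂ a)).2 ⟨0, ?_⟩
    rw [h6, h8]
    exact hneg _ (by rw [length_pre, Nat.add_mod_right, Nat.mod_eq_of_lt hlt])

end Forcing

section Compactness

instance : Countable Instr :=
  Function.Injective.countable (f := fun i : Instr => (i.k, i.idx, i.F)) fun i j h => by
    cases i; cases j; simpa using h

/-- A binary sequence listing the graph of `n ↦ f (I n)`. -/
def encode (f : Instr → ℕ) (I : ℕ → Instr) : ℕ → Bool :=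
  fun m => decide (f (I m.unpair.1) = m.unpair.2)

theorem continuous_encode (f : Instr → ℕ) : Continuous (encode f) :=
  continuous_pi fun m => (continuous_of_discreteTopology
    (f := fun i : Instr => decide (f i = m.unpair.2))).comp (continuous_apply _)

theorem encode_injective {f : Instr → ℕ} (hf : Function.Injective f) :
    Function.Injective (encode f) := by
  intro I J h
  funext n
  have := congrFun h (Nat.pair n (f (I n)))
  simp only [encode, Nat.unpair_pair, decide_true] at this
  exact (hf (of_decide_eq_true this.symm)).symm

theorem isLocallyConstant_pre (n : ℕ) : IsLocallyConstant fun z : Branch => pre z.1 n := by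
  induction n with
  | zero => exact IsLocallyConstant.const _
  | succ n ih =>
    have : IsLocallyConstant fun z : Branch => z.1 n :=
      (IsLocallyConstant.iff_continuous _).2 ((continuous_apply n).comp continuous_fst)
    exact this.comp₂ ih List.cons

theorem isLocallyConstant_num (n : ℕ) : IsLocallyConstant fun z : Branch => num z.2 n := by
  induction n with
  | zero => exact IsLocallyConstant.const _
  | succ n ih =>
    have : IsLocallyConstant fun z : Branch => z.2 n :=
      (IsLocallyConstant.iff_continuous _).2 ((continuous_apply n).comp continuous_snd)
    exact ih.comp₂ this fun s b => s + if b then 2 ^ n else 0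

variable (e : ℕ → Ordinal.{u}) (α : Ordinal.{u})

theorem isClosed_branches : IsClosed (branches e α) := by
  rw [branches, Set.ofPred_forall]
  refine isClosed_iInter fun n => ?_
  have := ((isLocallyConstant_pre n).comp₂ (isLocallyConstant_num n)
    fun u s => Good e α u ∧ Node e 0 u s).isClosed_fiber True
  simpa only [eq_iff_iff, iff_true] using this

theorem isCompact_branches : IsCompact (branches e α) := by
  let T : ℕ → Set Instr := fun n => {i | i.k ≤ n ∧ i.idx ≤ n ∧ i.F ⊆ Finset.range (2 ^ (n + 1))}
  have hT : ∀ n, (T n).Finite := by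
    intro n
    refine Set.Finite.of_finite_image (f := fun i : Instr => (i.k, i.idx, i.F)) ?_ ?_
    · refine ((Set.finite_Iic n).prod ((Set.finite_Iic n).prod
        (Finset.range (2 ^ (n + 1))).powerset.finite_toSet)).subset ?_
      rintro _ ⟨i, ⟨h1, h2, h3⟩, rfl⟩
      exact ⟨h1, h2, Finset.mem_coe.2 (Finset.mem_powerset.2 h3)⟩
    · intro i _ j _ h
      cases i; cases j; simpa using h
  refine ((isCompact_univ_pi fun n => (hT n).isCompact).prod isCompact_univ).of_isClosed_subset
    (isClosed_branches e α) ?_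
  rintro ⟨I, y⟩ h
  refine ⟨fun n _ => ?_, trivial⟩
  have hn := (h (n + 1)).1.2
  have hk : (I n).k ≤ n := by simpa only [length_pre] using hn.k_le
  refine ⟨hk, hn.idx_le.trans hk, fun s hs => ?_⟩
  simpa only [length_pre, Finset.mem_range] using hn.lt_of_mem s hs

end Compactness

theorem exists_compact_of_one_lt {α : Ordinal.{u}} (hα : 1 < α) (hc : (Set.Iio α).Countable) :
    ∃ K : Set ((ℕ → Bool) × (ℕ → Bool)),
      IsCompact K ∧
      (∀ x : ℕ → Bool, {y : ℕ → Bool | (x, y) ∈ K}.Countable) ∧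
      ¬ ∃ B : ℕ → Set ((ℕ → Bool) × (ℕ → Bool)),
          (∀ n : ℕ, B n ⊆ K) ∧ (⋃ n, B n) = K ∧
          (∀ n : ℕ, B n ∈ Sigma0 ((ℕ → Bool) × (ℕ → Bool)) α) ∧
          (∀ (n : ℕ) (x : ℕ → Bool), {y : ℕ → Bool | (x, y) ∈ B n}.Subsingleton) := by
  obtain ⟨e, hrange⟩ : ∃ e : ℕ → Ordinal.{u}, Set.Ico 1 α = Set.range e :=
    (hc.mono fun β hβ => hβ.2).exists_eq_range ⟨1, le_rfl, hα⟩
  have he : ∀ n, e n < α := fun n => (hrange.symm ▸ Set.mem_range_self n : e n ∈ Set.Ico 1 α).2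
  have hsurj : ∀ β, 1 ≤ β → β < α → ∃ j, e j = β := fun β h1 h2 => by
    have : β ∈ Set.Ico 1 α := ⟨h1, h2⟩
    rwa [hrange] at this
  have hIic : (Set.Iic α).Countable := by
    rw [← Set.Iio_insert]
    exact hc.insert α
  obtain ⟨f, hf⟩ := exists_injective_nat Instr
  let φ : Branch → (ℕ → Bool) × (ℕ → Bool) := fun z => (encode f z.1, z.2)
  have hφ : Continuous φ :=
    ((continuous_encode f).comp continuous_fst).prodMk continuous_snd
  refine ⟨φ '' branches e α, (isCompact_branches e α).image hφ, fun x => ?_, ?_⟩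
  · by_cases hx : ∃ z ∈ branches e α, encode f z.1 = x
    · obtain ⟨⟨I, z⟩, hI, rfl⟩ := hx
      refine (countable_branches he hIic fun n => (hI n).1).mono ?_
      rintro y ⟨⟨J, y'⟩, hJ, h⟩
      obtain ⟨h1, rfl⟩ := Prod.mk.inj h
      obtain rfl := encode_injective hf h1
      exact fun n => (hJ n).2
    · refine Set.countable_empty.mono ?_
      rintro y ⟨z, hz, h⟩
      exact hx ⟨z, hz, (Prod.mk.inj h).1⟩
  · rintro ⟨B, -, hBK, hBα, hBsub⟩
    have hB : ∀ n, ∃ A : ℕ → Set ((ℕ → Bool) × (ℕ → Bool)), ∃ β : ℕ → Ordinal.{u},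
        (∀ m, β m < α ∧ A m ∈ Sigma0 _ (β m)) ∧ B n = ⋃ m, (A m)ᶜ := by
      intro n
      have := hBα n
      rw [Sigma0] at this
      rcases this with ⟨h, _⟩ | ⟨_, A, β, h, hA⟩
      · exact absurd h hα.ne'
      · exact ⟨A, β, fun m => ⟨(h m).2.1, (h m).2.2⟩, hA⟩
    choose A β hA hBA using hB
    choose c hc hr hs using fun p : ℕ × ℕ => exists_code hφ (hA p.1 p.2).2
    obtain ⟨⟨n, m⟩, I, y, y', hne, h1, h2, h3, h4⟩ := exists_pair_notMem he hsurj
      (c := c) (fun p => ⟨hc p, (hr p).trans_lt (hA p.1 p.2).1⟩) (fun z hz => by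
        have : φ z ∈ ⋃ n, B n := hBK ▸ Set.mem_image_of_mem φ hz
        obtain ⟨n, hn⟩ := Set.mem_iUnion.1 this
        rw [hBA n] at hn
        obtain ⟨m, hm⟩ := Set.mem_iUnion.1 hn
        exact ⟨(n, m), fun h => hm (by rw [hs] at h; exact h)⟩)
    have key : ∀ z, (I, z) ∉ (c (n, m)).carrier → (encode f I, z) ∈ B n := by
      intro z hz
      rw [hBA n]
      refine Set.mem_iUnion.2 ⟨m, fun h => hz ?_⟩
      rw [hs]
      exact h
    exact hne (hBsub n (encode f I) (key y h3) (key y' h4))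

theorem not_isOpen_of_subset_singleton {S : Set ((ℕ → Bool) × (ℕ → Bool))}
    {p : (ℕ → Bool) × (ℕ → Bool)} (hS : S ⊆ {p}) (hp : p ∈ S) : ¬ IsOpen S := by
  intro h
  obtain ⟨U, V, _, hV, hU, hpV, hUV⟩ := isOpen_prod_iff.1 h p.1 p.2 hp
  obtain ⟨F, f, hf, hF⟩ := isOpen_pi_iff.1 hV p.2 hpV
  obtain ⟨k, hk⟩ := Infinite.exists_notMem_finset F
  have hq : Function.update p.2 k (!p.2 k) ∈ V := hF fun j hj => by
    rw [Function.update_of_ne (ne_of_mem_of_not_mem (Finset.mem_coe.1 hj) hk)]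
    exact (hf j hj).2
  have h1 : (p.1, Function.update p.2 k (!p.2 k)) = p := hS (hUV ⟨hU, hq⟩)
  have h2 := congrFun (congrArg Prod.snd h1) k
  simp at h2

theorem countable_Iio_of_lt {α : Ordinal.{u}} (hα : α < (Cardinal.aleph 1).ord) :
    (Set.Iio α).Countable := by
  rw [← Cardinal.le_aleph0_iff_set_countable, Cardinal.mk_Iio_ordinal, Cardinal.lift_le_aleph0]
  rw [Cardinal.lt_ord, ← Cardinal.succ_aleph0] at hα
  exact Order.lt_succ_iff.1 hα

end LuzinNovikov

/-- For every countable ordinal `α ≥ 1` there is a compact set `K ⊆ 2^ω × 2^ω` with all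
sections countable which cannot be covered by countably many `Σ⁰_α` sets with
at most one-point sections. -/
theorem no_bound_in_Luzin_Novikov_compact
    (α : Ordinal) (hα1 : 1 ≤ α) (hα2 : α < (Cardinal.aleph 1).ord) :
    ∃ K : Set ((ℕ → Bool) × (ℕ → Bool)),
      IsCompact K ∧
      (∀ x : ℕ → Bool, {y : ℕ → Bool | (x, y) ∈ K}.Countable) ∧
      ¬ ∃ B : ℕ → Set ((ℕ → Bool) × (ℕ → Bool)),
          (∀ n : ℕ, B n ⊆ K) ∧ (⋃ n, B n) = K ∧
          (∀ n : ℕ, B n ∈ Sigma0 ((ℕ → Bool) × (ℕ → Bool)) α) ∧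
          (∀ (n : ℕ) (x : ℕ → Bool), {y : ℕ → Bool | (x, y) ∈ B n}.Subsingleton) := by
  rcases hα1.eq_or_lt with rfl | hα1
  · refine ⟨{(fun _ => false, fun _ => false)}, isCompact_singleton, fun x => ?_, ?_⟩
    · refine Set.Subsingleton.countable ?_
      rintro y hy y' hy'
      exact (Prod.mk.inj hy).2.trans (Prod.mk.inj hy').2.symm
    · rintro ⟨B, hBK, hB, hBα, -⟩
      obtain ⟨n, hn⟩ := Set.mem_iUnion.1 (hB.symm ▸ Set.mem_singleton _)
      have := hBα n
      rw [Sigma0] at this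
      rcases this with ⟨_, h⟩ | ⟨h, _⟩
      · exact LuzinNovikov.not_isOpen_of_subset_singleton (hBK n) hn h
      · exact lt_irrefl _ h
  · exact LuzinNovikov.exists_compact_of_one_lt hα1 (LuzinNovikov.countable_Iio_of_lt hα2)
end
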